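/- Let Assumption W* hold, let Assumption B̲_{{α_n}} hold for a sequence α_n ↑ 1, and suppose the sequence of functions {u_{α_n}} is lower semi-equicontinuous on X. Then the pointwise function u(x) := liminf_{n→∞} u_{α_n}(x) coincides with liminf_{n→∞, y→x} u_{α_n}(y) for every x ∈ X, and there exists a deterministic policy φ satisfying the WACOI with this function u; consequently φ is average-cost optimal, u is lower semicontinuous, and for every x ∈ X, w(x) = w^φ(x) = limsup_{n→∞} (1−α_n) v_{α_n}(x) = limsup_{α↑1} (1−α) v_α(x) = w̄ = w̄_{{α_n}} = w*. -/

import Mathlib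

open MeasureTheory ProbabilityTheory Filter Topology Set
open scoped ENNReal NNReal

noncomputable section

/-- The nonnegative part of an extended real, as an element of `ℝ≥0∞`. -/
def eToENN (x : EReal) : ℝ≥0∞ := if x = ⊤ then ⊤ else ENNReal.ofReal x.toReal

/-- Extended integral of an `EReal`-valued function: positive part minus negative part. -/
def eInt {Y : Type*} [MeasurableSpace Y] (μ : Measure Y) (f : Y → EReal) : EReal :=
  ((∫⁻ y, eToENN (f y) ∂μ : ℝ≥0∞) : EReal) - ((∫⁻ y, eToENN (-(f y)) ∂μ : ℝ≥0∞) : EReal)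

/-- Extended sum of an `EReal`-valued series: positive part minus negative part. -/
def eSum (f : ℕ → EReal) : EReal :=
  ((∑' t, eToENN (f t) : ℝ≥0∞) : EReal) - ((∑' t, eToENN (-(f t)) : ℝ≥0∞) : EReal)

/-- Histories of length `t`: `(X × A) ^ t × X`. -/
abbrev Hist (X A : Type*) (t : ℕ) := (Fin t → X × A) × X

/-- A (randomized, history-dependent) policy: a regular transition probability from
histories to actions, at every time epoch. -/
structure Policy (X A : Type*) [MeasurableSpace X] [MeasurableSpace A] where
  π : ∀ t : ℕ, Kernel (Hist X A t) A
  markov : ∀ t, IsMarkovKernel (π t)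

/-- A Markov decision process with state space `X`, action space `A`, one-step cost `c`
(measurable and bounded below, with values in `(-∞, +∞]`) and transition probability `q`. -/
structure MDP (X A : Type*) [MeasurableSpace X] [MeasurableSpace A] where
  c : X → A → EReal
  q : Kernel (X × A) X
  markov : IsMarkovKernel q
  c_meas : Measurable fun p : X × A => c p.1 p.2
  c_ne_bot : ∃ K : ℝ, ∀ x a, (K : EReal) ≤ c x a

variable {X A : Type*} [MeasurableSpace X] [MeasurableSpace A]

/-- The deterministic policy given by a measurable map `φ : X → A` applied to the current state. -/
def detPolicy (φ : X → A) (hφ : Measurable φ) : Policy X A :=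
  ⟨fun t => Kernel.deterministic (fun h : Hist X A t => φ h.2) (hφ.comp measurable_snd),
   fun _ => by infer_instance⟩

/-- The distribution `P_x^π` of the history `h_t`, constructed recursively
(Ionescu-Tulcea finite-dimensional marginals). -/
def histMeas (M : MDP X A) (p : Policy X A) (x : X) : ∀ t : ℕ, Measure (Hist X A t)
  | 0 => Measure.dirac (Fin.elim0, x)
  | (t + 1) =>
      (histMeas M p x t).bind fun h =>
        ((p.π t) h).bind fun a =>
          (M.q (h.2, a)).map fun x' => (Fin.snoc h.1 (h.2, a), x')

/-- The joint distribution of the state-action pair `(x_t, a_t)` under `P_x^π`. -/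
def saMeas (M : MDP X A) (p : Policy X A) (x : X) (t : ℕ) : Measure (X × A) :=
  (histMeas M p x t).bind fun h => ((p.π t) h).map fun a => (h.2, a)

/-- `E_x^π c(x_t, a_t)`. -/
def expCost (M : MDP X A) (p : Policy X A) (x : X) (t : ℕ) : EReal :=
  eInt (saMeas M p x t) fun sa => M.c sa.1 sa.2

/-- The expected total discounted cost `v_α^π(x) = E_x^π ∑_t α^t c(x_t, a_t)`. -/
def vDisc (M : MDP X A) (α : ℝ) (p : Policy X A) (x : X) : EReal :=
  eSum fun t => ((α ^ t : ℝ) : EReal) * expCost M p x t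

/-- The finite-horizon expected total (undiscounted) cost `v_{N,1}^π(x)`. -/
def vFin (M : MDP X A) (N : ℕ) (p : Policy X A) (x : X) : EReal :=
  ∑ t ∈ Finset.range N, expCost M p x t

/-- The discounted value function `v_α(x) = inf_π v_α^π(x)`. -/
def vDiscOpt (M : MDP X A) (α : ℝ) (x : X) : EReal :=
  ⨅ p : Policy X A, vDisc M α p x

/-- The average cost per unit time `w^π(x)`. -/
def avgCost (M : MDP X A) (p : Policy X A) (x : X) : EReal :=
  Filter.limsup (fun N : ℕ => (((N : ℝ)⁻¹ : ℝ) : EReal) * vFin M N p x) atTop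

/-- The optimal average cost `w(x) = inf_π w^π(x)`. -/
def avgOpt (M : MDP X A) (x : X) : EReal :=
  ⨅ p : Policy X A, avgCost M p x

/-- `w* = inf_x w(x)`. -/
def wStar (M : MDP X A) : EReal := ⨅ x : X, avgOpt M x

/-- `m_α = inf_x v_α(x)`. -/
def mDisc (M : MDP X A) (α : ℝ) : EReal := ⨅ x : X, vDiscOpt M α x

/-- The discounted relative value function `u_α(x) = v_α(x) - m_α`. -/
def uDisc (M : MDP X A) (α : ℝ) (x : X) : EReal := vDiscOpt M α x - mDisc M α

/-- `w̄ = limsup_{α↑1} (1-α) m_α`. -/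
def wBar (M : MDP X A) : EReal :=
  Filter.limsup (fun α : ℝ => ((1 - α : ℝ) : EReal) * mDisc M α) (𝓝[Set.Ico (0:ℝ) 1] 1)

/-- `w̲ = liminf_{α↑1} (1-α) m_α`. -/
def wLow (M : MDP X A) : EReal :=
  Filter.liminf (fun α : ℝ => ((1 - α : ℝ) : EReal) * mDisc M α) (𝓝[Set.Ico (0:ℝ) 1] 1)

/-- `w̄_{{α_n}} = limsup_n (1-α_n) m_{α_n}`. -/
def wBarSeq (M : MDP X A) (a : ℕ → ℝ) : EReal :=
  Filter.limsup (fun n : ℕ => ((1 - a n : ℝ) : EReal) * mDisc M (a n)) atTop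

/-- `w̲_{{α_n}} = liminf_n (1-α_n) m_{α_n}`. -/
def wLowSeq (M : MDP X A) (a : ℕ → ℝ) : EReal :=
  Filter.liminf (fun n : ℕ => ((1 - a n : ℝ) : EReal) * mDisc M (a n)) atTop


section TopologicalAssumptions

variable {X A : Type*} [MetricSpace X] [TopologicalSpace.SeparableSpace X]
  [MeasurableSpace X] [BorelSpace X] [StandardBorelSpace X]
  [MetricSpace A] [TopologicalSpace.SeparableSpace A]
  [MeasurableSpace A] [BorelSpace A] [StandardBorelSpace A]

/-- Assumption W*(i): the cost `c` is `K`-inf-compact, i.e., for every nonempty compact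
`K ⊆ X`, the restriction of `c` to `K × A` has compact sublevel sets. -/
def AssumptionWi (M : MDP X A) : Prop :=
  ∀ K : Set X, K.Nonempty → IsCompact K →
    ∀ lam : ℝ, IsCompact {p : X × A | p.1 ∈ K ∧ M.c p.1 p.2 ≤ (lam : EReal)}

/-- Assumption W*(ii): the transition probability `q(·|x,a)` is weakly continuous in `(x,a)`. -/
def AssumptionWii (M : MDP X A) : Prop :=
  ∀ f : BoundedContinuousFunction X ℝ, Continuous fun p : X × A => ∫ y, f y ∂ (M.q p)

/-- Assumption S*(i): for each `x`, the function `a ↦ c(x,a)` has compact sublevel sets. -/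
def AssumptionSi (M : MDP X A) : Prop :=
  ∀ x : X, ∀ lam : ℝ, IsCompact {a : A | M.c x a ≤ (lam : EReal)}

/-- Assumption S*(ii): for each `x`, the transition probability `q(·|x,a)` is setwise
continuous in `a`. -/
def AssumptionSii (M : MDP X A) : Prop :=
  ∀ x : X, ∀ B : Set X, MeasurableSet B → Continuous fun a : A => M.q (x, a) B

end TopologicalAssumptions

section Statements

variable {X A : Type*} [MetricSpace X] [TopologicalSpace.SeparableSpace X]
  [MeasurableSpace X] [BorelSpace X] [StandardBorelSpace X]
  [MetricSpace A] [TopologicalSpace.SeparableSpace A]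
  [MeasurableSpace A] [BorelSpace A] [StandardBorelSpace A]

/-- The pointwise lower limit `u(x) = liminf_{n→∞} u_{α_n}(x)`. -/
def uPointwise (M : MDP X A) (a : ℕ → ℝ) (x : X) : EReal :=
  Filter.liminf (fun n : ℕ => uDisc M (a n) x) atTop

/-- The function `u(x) = liminf_{n→∞, y→x} u_{α_n}(y)`: the lower limit of
`(n,y) ↦ u_{α_n}(y)` along the product of `atTop` and the neighborhood filter of `x`. -/
def uEqnOne (M : MDP X A) (a : ℕ → ℝ) (x : X) : EReal :=
  Filter.liminf (fun p : ℕ × X => uDisc M (a p.1) p.2) ((atTop : Filter ℕ) ×ˢ 𝓝 x)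

/-! ### Topological and measure-theoretic preliminaries -/

/-- A subset of a product of metric spaces is closed as soon as its parts above the compact
subsets of the first factor are compact. -/
lemma isClosed_of_isCompact_fst_preimage {Y B : Type*} [MetricSpace Y] [MetricSpace B]
    {S : Set (Y × B)}
    (h : ∀ K : Set Y, K.Nonempty → IsCompact K → IsCompact {p | p.1 ∈ K ∧ p ∈ S}) :
    IsClosed S := by
  refine IsSeqClosed.isClosed fun p p₀ hp hlim => ?_
  have hfst : Tendsto (fun n => (p n).1) atTop (𝓝 p₀.1) := (continuous_fst.tendsto _).comp hlim
  have hK := h _ (insert_nonempty _ _) hfst.isCompact_insert_range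
  exact (hK.isClosed.mem_of_tendsto hlim
    (Eventually.of_forall fun n => ⟨mem_insert_of_mem _ (mem_range_self n), hp n⟩)).2

/-- A subset of a metric space is closed as soon as its traces on compact sets are compact. -/
lemma isClosed_of_isCompact_inter {Y : Type*} [MetricSpace Y] {S : Set Y}
    (h : ∀ K : Set Y, K.Nonempty → IsCompact K → IsCompact (K ∩ S)) : IsClosed S := by
  refine IsSeqClosed.isClosed fun y y₀ hy hlim => ?_
  have hK := h _ (insert_nonempty _ _) hlim.isCompact_insert_range
  exact (hK.isClosed.mem_of_tendsto hlim
    (Eventually.of_forall fun n => ⟨mem_insert_of_mem _ (mem_range_self n), hy n⟩)).2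

/-- The integral of a finite nonnegative lower semicontinuous function is lower semicontinuous
with respect to weakly continuous perturbations of the measure. -/
lemma lowerSemicontinuous_lintegral_of_weakly_continuous {Y P : Type*} [MetricSpace Y]
    [MeasurableSpace Y] [BorelSpace Y] [TopologicalSpace P] [FirstCountableTopology P]
    {μ : P → Measure Y} [hμ : ∀ p, IsProbabilityMeasure (μ p)]
    (hcont : ∀ f : BoundedContinuousFunction Y ℝ, Continuous fun p => ∫ y, f y ∂(μ p))
    {U : Y → ℝ≥0∞} (hU : LowerSemicontinuous U) (hfin : ∀ y, U y ≠ ⊤) :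
    LowerSemicontinuous fun p => ∫⁻ y, U y ∂(μ p) := by
  have hmeas : Measurable U := hU.measurable
  have layer : ∀ p, ∫⁻ y, U y ∂(μ p)
      = ∫⁻ t in Ioi (0 : ℝ), (μ p) {y | t < (U y).toReal} := fun p => by
    rw [← lintegral_eq_lintegral_meas_lt (μ p) (Eventually.of_forall fun y => ENNReal.toReal_nonneg)
      hmeas.ennreal_toReal.aemeasurable]
    exact lintegral_congr fun y => (ENNReal.ofReal_toReal (hfin y)).symm
  refine lowerSemicontinuous_iff_le_liminf.2 fun p₀ => ?_
  let ν : P → ProbabilityMeasure Y := fun p => ⟨μ p, hμ p⟩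
  have hlim : Tendsto ν (𝓝 p₀) (𝓝 (ν p₀)) :=
    ProbabilityMeasure.tendsto_iff_forall_integral_tendsto.2 fun f => (hcont f).tendsto p₀
  have hopen : ∀ t ∈ Ioi (0 : ℝ), IsOpen {y | t < (U y).toReal} := fun t ht => by
    have : {y | t < (U y).toReal} = U ⁻¹' Ioi (ENNReal.ofReal t) := by
      ext y
      simp [ENNReal.ofReal_lt_iff_lt_toReal (le_of_lt ht) (hfin y)]
    rw [this]
    exact hU.isOpen_preimage _
  simp only [layer]
  calc ∫⁻ t in Ioi (0 : ℝ), (μ p₀) {y | t < (U y).toReal}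
      ≤ ∫⁻ t in Ioi (0 : ℝ), liminf (fun p => (μ p) {y | t < (U y).toReal}) (𝓝 p₀) :=
        setLIntegral_mono' measurableSet_Ioi fun t ht =>
          ProbabilityMeasure.le_liminf_measure_open_of_tendsto hlim (hopen t ht)
    _ ≤ _ := lintegral_liminf_le fun p => Antitone.measurable fun s t hst =>
          measure_mono fun y hy => lt_of_le_of_lt hst hy

/-! ### Measurable selection from compact-valued maps -/

/-- The points of `D x` at which the function `f` is minimal. -/
def argminOn {Y B : Type*} (f : B → ℝ) (D : Y → Set B) (x : Y) : Set B :=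
  {b ∈ D x | ∀ b' ∈ D x, f b ≤ f b'}

/-- A set-valued map with nonempty compact values that hits closed sets measurably. -/
structure IsCompactMeasurable {Y B : Type*} [MeasurableSpace Y] [TopologicalSpace B]
    (D : Y → Set B) : Prop where
  nonempty : ∀ x, (D x).Nonempty
  compact : ∀ x, IsCompact (D x)
  measurableSet_hit : ∀ C, IsClosed C → MeasurableSet {x | (D x ∩ C).Nonempty}

lemma IsCompactMeasurable.argminOn {Y B : Type*} [MeasurableSpace Y] [TopologicalSpace B]
    {D : Y → Set B} (hD : IsCompactMeasurable D) {f : B → ℝ} (hf : Continuous f) :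
    IsCompactMeasurable (argminOn f D) where
  nonempty x := by
    obtain ⟨b, hb, hmin⟩ := (hD.compact x).exists_isMinOn (hD.nonempty x) hf.continuousOn
    exact ⟨b, hb, fun b' hb' => hmin hb'⟩
  compact x := by
    have : _root_.argminOn f D x = D x ∩ ⋂ b' ∈ D x, {b | f b ≤ f b'} := by
      ext b
      simp [_root_.argminOn]
    rw [this]
    exact (hD.compact x).inter_right
      (isClosed_biInter fun b' _ => isClosed_le hf continuous_const)
  measurableSet_hit C hC := by
    have hcl : ∀ r : ℚ, IsClosed {b | f b ≤ r} := fun r => isClosed_le hf continuous_const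
    have : {x | (_root_.argminOn f D x ∩ C).Nonempty} =
        ⋂ r : ℚ, ({x | (D x ∩ {b | f b ≤ r}).Nonempty}ᶜ
          ∪ {x | (D x ∩ (C ∩ {b | f b ≤ r})).Nonempty}) := by
      ext x
      simp only [mem_iInter, mem_union, mem_compl_iff, mem_ofPred_eq, ← imp_iff_not_or]
      constructor
      · rintro ⟨b, ⟨hb, hmin⟩, hbC⟩ r ⟨b', hb', hr⟩
        exact ⟨b, hb, hbC, (hmin b' hb').trans hr⟩
      · intro h
        obtain ⟨b₁, hb₁, hmin₁⟩ :=
          (hD.compact x).exists_isMinOn (hD.nonempty x) hf.continuousOn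
        obtain ⟨r₀, hr₀⟩ := exists_rat_gt (f b₁)
        obtain ⟨b₂, hb₂, hC₂, -⟩ := h r₀ ⟨b₁, hb₁, hr₀.le⟩
        obtain ⟨b, ⟨hb, hbC⟩, hmin⟩ := ((hD.compact x).inter_right hC).exists_isMinOn
          ⟨b₂, hb₂, hC₂⟩ hf.continuousOn
        refine ⟨b, ⟨hb, fun b' hb' => ?_⟩, hbC⟩
        refine le_trans ?_ (hmin₁ hb')
        refine le_of_forall_gt fun s hs => ?_
        obtain ⟨r, hr, hrs⟩ := exists_rat_btwn hs
        obtain ⟨b₃, hb₃, hC₃, hle⟩ := h r ⟨b₁, hb₁, hr.le⟩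
        exact ((hmin ⟨hb₃, hC₃⟩ : f b ≤ f b₃).trans hle).trans_lt hrs
    rw [this]
    exact MeasurableSet.iInter fun r => (hD.measurableSet_hit _ (hcl r)).compl.union
      (hD.measurableSet_hit _ (hC.inter (hcl r)))

/-- A compact-valued map into a separable metric space that hits closed sets measurably has a
measurable selector. -/
theorem IsCompactMeasurable.exists_measurable_selector {Y B : Type*} [MeasurableSpace Y]
    [MetricSpace B] [TopologicalSpace.SeparableSpace B] [Nonempty B] [MeasurableSpace B]
    [BorelSpace B] {D : Y → Set B} (hD : IsCompactMeasurable D) :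
    ∃ φ : Y → B, Measurable φ ∧ ∀ x, φ x ∈ D x := by
  let d : ℕ → B := TopologicalSpace.denseSeq B
  let E : ℕ → Y → Set B := fun n =>
    Nat.rec D (fun i F => _root_.argminOn (fun b => dist b (d i)) F) n
  have hE : ∀ n, IsCompactMeasurable (E n) := fun n => by
    induction n with
    | zero => exact hD
    | succ i ih => exact ih.argminOn (f := fun b => dist b (d i)) (by fun_prop)
  have hsub : ∀ i x, E (i + 1) x ⊆ E i x := fun i x b hb => hb.1
  have hne : ∀ x, (⋂ i, E i x).Nonempty := fun x =>
    IsCompact.nonempty_iInter_of_sequence_nonempty_isCompact_isClosed _ (fun i => hsub i x)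
      (fun i => (hE i).nonempty x) ((hE 0).compact x) fun i => ((hE i).compact x).isClosed
  choose φ hφ using hne
  have hφE : ∀ i x, φ x ∈ E i x := fun i x => mem_iInter.1 (hφ x) i
  refine ⟨φ, ?_, hφE 0⟩
  have hball : ∀ i (r : ℚ), MeasurableSet (φ ⁻¹' Metric.closedBall (d i) r) := fun i r => by
    have : φ ⁻¹' Metric.closedBall (d i) r = {x | (E i x ∩ Metric.closedBall (d i) r).Nonempty} := by
      ext x
      constructor
      · exact fun h => ⟨φ x, hφE i x, h⟩
      · rintro ⟨b, hb, hr⟩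
        exact ((hφE (i + 1) x).2 b hb).trans hr
    rw [this]
    exact (hE i).measurableSet_hit _ Metric.isClosed_closedBall
  refine measurable_of_isOpen fun U hU => ?_
  have : φ ⁻¹' U = ⋃ (i : ℕ) (r : ℚ) (_ : Metric.closedBall (d i) (r : ℝ) ⊆ U),
      φ ⁻¹' Metric.closedBall (d i) r := by
    ext x
    simp only [mem_iUnion, mem_preimage, exists_prop]
    constructor
    · intro hx
      obtain ⟨ε, hε, hεU⟩ := Metric.isOpen_iff.1 hU _ hx
      obtain ⟨r, hr0, hr⟩ := exists_rat_btwn (half_pos hε)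
      obtain ⟨i, hi⟩ := (TopologicalSpace.denseRange_denseSeq B).exists_dist_lt (φ x) hr0
      refine ⟨i, r, fun b hb => hεU ?_, hi.le⟩
      calc dist b (φ x) ≤ dist b (d i) + dist (d i) (φ x) := dist_triangle _ _ _
        _ < ε := by
          have h₁ : dist b (d i) ≤ r := hb
          have h₂ : dist (d i) (φ x) < r := by rw [dist_comm]; exact hi
          linarith
    · rintro ⟨i, r, hU, hx⟩
      exact hU hx
  rw [this]
  exact MeasurableSet.iUnion fun i => MeasurableSet.iUnion fun r => MeasurableSet.iUnion
    fun _ => hball i r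

/-! ### An Abelian inequality -/

lemma ENNReal.one_sub_mul_tsum_pow_mul_sum_range (α : ℝ≥0∞) (hα : α < 1) (C : ℕ → ℝ≥0∞) :
    (1 - α) * ∑' n, α ^ n * ∑ t ∈ Finset.range (n + 1), C t = ∑' t, α ^ t * C t := by
  have h1 : (1 - α) ≠ 0 := (tsub_pos_of_lt hα).ne'
  have h2 : (1 - α) ≠ ⊤ := (tsub_le_self.trans_lt ENNReal.one_lt_top).ne
  have hgeo : ∀ t, (1 - α) * ∑' n, (if t ≤ n then α ^ n else 0) = α ^ t := fun t => by
    rw [← (ENNReal.summable).sum_add_tsum_nat_add' (k := t)]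
    rw [Finset.sum_eq_zero fun i hi => if_neg (not_le.2 (Finset.mem_range.1 hi)), zero_add]
    simp only [Nat.le_add_left, if_true, pow_add]
    rw [ENNReal.tsum_mul_right, ENNReal.tsum_geometric, ← mul_assoc, ENNReal.mul_inv_cancel h1 h2,
      one_mul]
  calc (1 - α) * ∑' n, α ^ n * ∑ t ∈ Finset.range (n + 1), C t
      = (1 - α) * ∑' n, ∑' t, (if t ≤ n then α ^ n else 0) * C t := by
        congr 2 with n
        rw [tsum_eq_sum (s := Finset.range (n + 1)), Finset.mul_sum]
        · exact Finset.sum_congr rfl fun t ht => by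
            rw [if_pos (Nat.lt_succ_iff.1 (Finset.mem_range.1 ht))]
        · intro t ht
          rw [if_neg (by simpa using ht), zero_mul]
    _ = ∑' t, ((1 - α) * ∑' n, (if t ≤ n then α ^ n else 0)) * C t := by
        rw [ENNReal.tsum_comm, ← ENNReal.tsum_mul_left]
        congr 1 with t
        rw [ENNReal.tsum_mul_right, mul_assoc]
    _ = _ := by simp only [hgeo]

/-- The upper Abel limit is bounded by the upper Cesàro limit. -/
theorem ENNReal.limsup_abel_le_limsup_cesaro (C : ℕ → ℝ≥0∞) :
    limsup (fun α : ℝ => ENNReal.ofReal (1 - α) * ∑' t, ENNReal.ofReal α ^ t * C t)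
        (𝓝[Ico (0 : ℝ) 1] 1)
      ≤ limsup (fun N : ℕ => (N : ℝ≥0∞)⁻¹ * ∑ t ∈ Finset.range N, C t) atTop := by
  refine le_of_forall_gt fun L hL => ?_
  obtain ⟨L', hL', hLL⟩ := exists_between hL
  have hfin : L' ≠ ⊤ := hLL.ne_top
  obtain ⟨N₀, hN₀⟩ := eventually_atTop.1 (eventually_lt_of_limsup_lt hL')
  have hS : ∀ N ≥ N₀ + 1, ∑ t ∈ Finset.range N, C t ≤ N * L' := fun N hN => by
    have h := (hN₀ N (by omega)).le
    have hN0 : (N : ℝ≥0∞) ≠ 0 := by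
      rw [Ne, Nat.cast_eq_zero]
      omega
    rw [mul_comm, ← div_eq_mul_inv,
      ENNReal.div_le_iff hN0 (ENNReal.natCast_ne_top N)] at h
    rwa [mul_comm]
  set B := ∑ t ∈ Finset.range (N₀ + 1), C t with hB
  have hBfin : B ≠ ⊤ :=
    ((hS _ le_rfl).trans_lt (ENNReal.mul_lt_top (ENNReal.natCast_lt_top _) hfin.lt_top)).ne
  have hS' : ∀ n, ∑ t ∈ Finset.range (n + 1), C t
      ≤ (∑ t ∈ Finset.range (n + 1), L') + B := fun n => by
    rcases le_total (N₀ + 1) (n + 1) with h | h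
    · refine le_add_right ((hS _ h).trans ?_)
      simp
    · exact le_add_left (Finset.sum_le_sum_of_subset (Finset.range_mono h))
  have hbound : ∀ᶠ α in 𝓝[Ico (0 : ℝ) 1] 1,
      ENNReal.ofReal (1 - α) * ∑' t, ENNReal.ofReal α ^ t * C t
        ≤ L' + ENNReal.ofReal (1 - α) * B := by
    filter_upwards [self_mem_nhdsWithin] with α hα
    have hα1 : ENNReal.ofReal α < 1 := by
      rw [← ENNReal.ofReal_one]
      exact (ENNReal.ofReal_lt_ofReal_iff one_pos).2 hα.2
    have hsub : ENNReal.ofReal (1 - α) = 1 - ENNReal.ofReal α := by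
      rw [ENNReal.ofReal_sub _ hα.1, ENNReal.ofReal_one]
    have h1 : (1 - ENNReal.ofReal α) ≠ 0 := (tsub_pos_of_lt hα1).ne'
    have h2 : (1 - ENNReal.ofReal α) ≠ ⊤ := (tsub_le_self.trans_lt ENNReal.one_lt_top).ne
    rw [hsub]
    set β := ENNReal.ofReal α
    calc (1 - β) * ∑' t, β ^ t * C t
        = (1 - β) * ((1 - β) * ∑' n, β ^ n * ∑ t ∈ Finset.range (n + 1), C t) := by
          rw [ENNReal.one_sub_mul_tsum_pow_mul_sum_range β hα1]
      _ ≤ (1 - β) * ((1 - β) * ∑' n, β ^ n * ((∑ t ∈ Finset.range (n + 1), L') + B)) := by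
          gcongr with n
          exact hS' n
      _ = (1 - β) * (((1 - β) * ∑' n, β ^ n * ∑ t ∈ Finset.range (n + 1), L')
            + (1 - β) * ((1 - β)⁻¹ * B)) := by
          simp only [mul_add, ENNReal.tsum_add]
          rw [ENNReal.tsum_mul_right, ENNReal.tsum_geometric]
      _ = L' + (1 - β) * B := by
          rw [ENNReal.one_sub_mul_tsum_pow_mul_sum_range β hα1 fun _ => L', ENNReal.tsum_mul_right,
            ENNReal.tsum_geometric, ← mul_assoc (1 - β) (1 - β)⁻¹, ENNReal.mul_inv_cancel h1 h2,
            one_mul, mul_add, ← mul_assoc, ENNReal.mul_inv_cancel h1 h2, one_mul]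
  have hlim : Tendsto (fun α : ℝ => L' + ENNReal.ofReal (1 - α) * B) (𝓝[Ico (0 : ℝ) 1] 1)
      (𝓝 L') := by
    have h0 : Tendsto (fun α : ℝ => ENNReal.ofReal (1 - α)) (𝓝[Ico (0 : ℝ) 1] 1) (𝓝 0) := by
      have : Continuous fun α : ℝ => ENNReal.ofReal (1 - α) :=
        ENNReal.continuous_ofReal.comp (by fun_prop)
      simpa using (this.tendsto 1).mono_left nhdsWithin_le_nhds
    simpa using (ENNReal.Tendsto.mul_const h0 (Or.inr hBfin)).const_add L'
  have : (𝓝[Ico (0 : ℝ) 1] (1 : ℝ)).NeBot := right_nhdsWithin_Ico_neBot one_pos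
  calc _ ≤ limsup (fun α : ℝ => L' + ENNReal.ofReal (1 - α) * B) (𝓝[Ico (0 : ℝ) 1] 1) :=
        limsup_le_limsup hbound
    _ = L' := hlim.limsup_eq
    _ < L := hLL

/-! ### Integration along the controlled process -/

section ControlledChain

variable {S B : Type*} [MeasurableSpace S] [MeasurableSpace B]

instance (M : MDP S B) : IsMarkovKernel M.q := M.markov

instance (p : Policy S B) (t : ℕ) : IsMarkovKernel (p.π t) := p.markov t

/-- Extend a history by an action and a new state. -/
def Hist.extend {t : ℕ} (h : Hist S B t) (b : B) (y : S) : Hist S B (t + 1) :=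
  (Fin.snoc h.1 (h.2, b), y)

/-- Prepend a state-action pair to a history. -/
def Hist.prepend (z : S × B) {t : ℕ} (h : Hist S B t) : Hist S B (t + 1) :=
  (Fin.cons z h.1, h.2)

lemma Hist.prepend_extend {S B : Type*} (z : S × B) {t : ℕ} (h : Hist S B t) (b : B) (y : S) :
    Hist.prepend z (Hist.extend h b y) = Hist.extend (Hist.prepend z h) b y := by
  simp only [Hist.prepend, Hist.extend]
  rw [Fin.cons_snoc_eq_snoc_cons]

lemma Hist.measurable_extend {t : ℕ} :
    Measurable fun w : (Hist S B t × B) × S => Hist.extend w.1.1 w.1.2 w.2 := by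
  refine Measurable.prodMk (measurable_pi_iff.2 fun i => ?_) measurable_snd
  refine Fin.lastCases ?_ (fun j => ?_) i
  · simp only [Fin.snoc_last]
    fun_prop
  · simp only [Fin.snoc_castSucc]
    fun_prop

lemma Hist.measurable_extend_right {t : ℕ} (h : Hist S B t) (b : B) :
    Measurable (Hist.extend h b) :=
  Hist.measurable_extend.comp
    (measurable_prodMk_left : Measurable fun y : S => (((h, b), y) : (Hist S B t × B) × S))

lemma Hist.measurable_prepend {t : ℕ} :
    Measurable fun w : (S × B) × Hist S B t => Hist.prepend w.1 w.2 := by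
  refine Measurable.prodMk (measurable_pi_iff.2 fun i => ?_) (by fun_prop)
  refine Fin.cases ?_ (fun j => ?_) i
  · simp only [Fin.cons_zero]
    fun_prop
  · simp only [Fin.cons_succ]
    fun_prop

/-- Expected value of a function of the extended history, given the current history. -/
def stepInt (M : MDP S B) (p : Policy S B) {t : ℕ} (f : Hist S B (t + 1) → ℝ≥0∞)
    (h : Hist S B t) : ℝ≥0∞ :=
  ∫⁻ b, ∫⁻ y, f (Hist.extend h b y) ∂(M.q (h.2, b)) ∂(p.π t h)

lemma measurable_lintegral_transition (M : MDP S B) {t : ℕ} {Z : Type*} [MeasurableSpace Z]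
    {f : Z → Hist S B t → B → S → ℝ≥0∞}
    (hf : Measurable fun w : ((Z × Hist S B t) × B) × S => f w.1.1.1 w.1.1.2 w.1.2 w.2) :
    Measurable fun w : (Z × Hist S B t) × B =>
      ∫⁻ y, f w.1.1 w.1.2 w.2 y ∂(M.q (w.1.2.2, w.2)) := by
  let κ : Kernel ((Z × Hist S B t) × B) S := M.q.comap (fun w => (w.1.2.2, w.2)) (by fun_prop)
  exact Measurable.lintegral_kernel_prod_right' (κ := κ) hf

lemma measurable_stepMeas (M : MDP S B) (p : Policy S B) (t : ℕ) :
    (∀ h : Hist S B t, Measurable fun b => (M.q (h.2, b)).map (Hist.extend h b)) ∧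
    Measurable fun h : Hist S B t =>
      (p.π t h).bind fun b => (M.q (h.2, b)).map (Hist.extend h b) := by
  have hjoint : Measurable fun w : Hist S B t × B =>
      (M.q (w.1.2, w.2)).map (Hist.extend w.1 w.2) := by
    refine Measure.measurable_of_measurable_coe _ fun s hs => ?_
    simp_rw [Measure.map_apply (Hist.measurable_extend_right _ _) hs]
    let κ : Kernel (Hist S B t × B) S := M.q.comap (fun w => (w.1.2, w.2)) (by fun_prop)
    exact Kernel.measurable_kernel_prodMk_left (κ := κ) (Hist.measurable_extend hs)
  have hsec : ∀ h : Hist S B t, Measurable fun b => (M.q (h.2, b)).map (Hist.extend h b) :=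
    fun h => hjoint.comp measurable_prodMk_left
  refine ⟨hsec, Measure.measurable_of_measurable_coe _ fun s hs => ?_⟩
  simp_rw [Measure.bind_apply hs (hsec _).aemeasurable]
  exact Measurable.lintegral_kernel_prod_right'
    ((Measure.measurable_coe hs).comp hjoint)

lemma lintegral_histMeas_zero (M : MDP S B) (p : Policy S B) (x : S)
    {f : Hist S B 0 → ℝ≥0∞} (hf : Measurable f) :
    ∫⁻ h, f h ∂(histMeas M p x 0) = f (Fin.elim0, x) := by
  rw [histMeas, lintegral_dirac' _ hf]

lemma lintegral_histMeas_succ (M : MDP S B) (p : Policy S B) (x : S) (t : ℕ)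
    {f : Hist S B (t + 1) → ℝ≥0∞} (hf : Measurable f) :
    ∫⁻ h, f h ∂(histMeas M p x (t + 1)) = ∫⁻ h, stepInt M p f h ∂(histMeas M p x t) := by
  obtain ⟨hsec, hstep⟩ := measurable_stepMeas M p t
  have : histMeas M p x (t + 1) = (histMeas M p x t).bind fun h : Hist S B t =>
      (p.π t h).bind fun b => (M.q (h.2, b)).map (Hist.extend h b) := rfl
  rw [this, Measure.lintegral_bind hstep.aemeasurable hf.aemeasurable]
  refine lintegral_congr fun h => ?_
  rw [Measure.lintegral_bind (hsec h).aemeasurable hf.aemeasurable]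
  exact lintegral_congr fun b => lintegral_map hf
    (Hist.measurable_extend_right h b)

lemma measurable_stepInt (M : MDP S B) (p : Policy S B) {t : ℕ} {f : Hist S B (t + 1) → ℝ≥0∞}
    (hf : Measurable f) : Measurable (stepInt M p f) := by
  have h := (measurable_lintegral_transition M (Z := Unit) (t := t)
    (f := fun _ h b y => f (Hist.extend h b y))
    (hf.comp (Hist.measurable_extend.comp (by fun_prop :
      Measurable fun w : ((Unit × Hist S B t) × B) × S => ((w.1.1.2, w.1.2), w.2))))).comp
    (by fun_prop : Measurable fun w : Hist S B t × B => (((), w.1), w.2))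
  exact Measurable.lintegral_kernel_prod_right' h

instance isProbabilityMeasure_histMeas (M : MDP S B) (p : Policy S B) (x : S) (t : ℕ) :
    IsProbabilityMeasure (histMeas M p x t) := by
  induction t with
  | zero => exact Measure.dirac.isProbabilityMeasure
  | succ t ih =>
    refine ⟨?_⟩
    rw [← lintegral_one, lintegral_histMeas_succ M p x t measurable_const]
    simp [stepInt]

/-- Expected value at time `t` of a nonnegative function of the current state and action. -/
def stageInt (M : MDP S B) (p : Policy S B) (g : S × B → ℝ≥0∞) (x : S) (t : ℕ) : ℝ≥0∞ :=
  ∫⁻ h, ∫⁻ b, g (h.2, b) ∂(p.π t h) ∂(histMeas M p x t)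

lemma measurable_lintegral_policy (p : Policy S B) (t : ℕ) {g : S × B → ℝ≥0∞}
    (hg : Measurable g) : Measurable fun h : Hist S B t => ∫⁻ b, g (h.2, b) ∂(p.π t h) :=
  Measurable.lintegral_kernel_prod_right'
    (hg.comp (by fun_prop : Measurable fun w : Hist S B t × B => (w.1.2, w.2)))

lemma saMeas_aux (p : Policy S B) (t : ℕ) :
    Measurable fun h : Hist S B t => (p.π t h).map fun b => (h.2, b) := by
  refine Measure.measurable_of_measurable_coe _ fun s hs => ?_
  simp_rw [Measure.map_apply measurable_prodMk_left hs]
  exact Kernel.measurable_kernel_prodMk_left (κ := p.π t)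
    ((by fun_prop : Measurable fun w : Hist S B t × B => (w.1.2, w.2)) hs)

lemma lintegral_saMeas (M : MDP S B) (p : Policy S B) (x : S) (t : ℕ) {g : S × B → ℝ≥0∞}
    (hg : Measurable g) : ∫⁻ z, g z ∂(saMeas M p x t) = stageInt M p g x t := by
  rw [saMeas, Measure.lintegral_bind (saMeas_aux p t).aemeasurable hg.aemeasurable]
  exact lintegral_congr fun h => lintegral_map hg measurable_prodMk_left

instance isProbabilityMeasure_saMeas (M : MDP S B) (p : Policy S B) (x : S) (t : ℕ) :
    IsProbabilityMeasure (saMeas M p x t) := by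
  refine ⟨?_⟩
  rw [← lintegral_one, lintegral_saMeas M p x t measurable_const]
  simp [stageInt]

lemma stageInt_zero (M : MDP S B) (p : Policy S B) {g : S × B → ℝ≥0∞} (hg : Measurable g)
    (x : S) : stageInt M p g x 0 = ∫⁻ b, g (x, b) ∂(p.π 0 (Fin.elim0, x)) :=
  lintegral_histMeas_zero M p x (measurable_lintegral_policy p 0 hg)

/-- The policy followed from time one on, once the first state-action pair is known. -/
def Policy.shift (p : Policy S B) (z : S × B) : Policy S B where
  π t := (p.π (t + 1)).comap (Hist.prepend z)
    (Hist.measurable_prepend.comp measurable_prodMk_left)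
  markov _ := Kernel.IsMarkovKernel.comap _ _

lemma lintegral_histMeas_shift (M : MDP S B) (p : Policy S B) (x : S) (t : ℕ)
    {f : Hist S B (t + 1) → ℝ≥0∞} (hf : Measurable f) :
    ∫⁻ h, f h ∂(histMeas M p x (t + 1)) =
      ∫⁻ b, ∫⁻ y, ∫⁻ h, f (Hist.prepend (x, b) h) ∂(histMeas M (p.shift (x, b)) y t)
        ∂(M.q (x, b)) ∂(p.π 0 (Fin.elim0, x)) := by
  have hpre : ∀ (b : B) {t : ℕ} {f : Hist S B (t + 1) → ℝ≥0∞}, Measurable f →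
      Measurable fun h => f (Hist.prepend (x, b) h) := fun b t f hf =>
    hf.comp (Hist.measurable_prepend.comp measurable_prodMk_left)
  induction t with
  | zero =>
    rw [lintegral_histMeas_succ M p x 0 hf,
      lintegral_histMeas_zero M p x (measurable_stepInt M p hf)]
    refine lintegral_congr fun b => lintegral_congr fun y => ?_
    rw [lintegral_histMeas_zero _ _ _ (hpre b hf)]
    have : Hist.extend ((Fin.elim0, x) : Hist S B 0) b y = Hist.prepend (x, b) (Fin.elim0, y) :=
      Prod.ext (funext fun i => by obtain rfl : i = 0 := Fin.ext (by omega); rfl) rfl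
    rw [this]
  | succ t ih =>
    rw [lintegral_histMeas_succ M p x (t + 1) hf, ih (measurable_stepInt M p hf)]
    refine lintegral_congr fun b => lintegral_congr fun y => ?_
    rw [lintegral_histMeas_succ _ _ _ _ (hpre b hf)]
    refine lintegral_congr fun h => ?_
    simp only [stepInt, Hist.prepend_extend]
    rfl

lemma measurable_lintegral_histMeas_shift (M : MDP S B) (p : Policy S B) (x : S) (t : ℕ)
    {f : B → Hist S B t → ℝ≥0∞} (hf : Measurable (Function.uncurry f)) :
    Measurable fun w : B × S => ∫⁻ h, f w.1 h ∂(histMeas M (p.shift (x, w.1)) w.2 t) := by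
  induction t with
  | zero =>
    have hsec : ∀ b, Measurable (f b) := fun b => hf.comp measurable_prodMk_left
    have hz : ∀ w : B × S, _ := fun w =>
      lintegral_histMeas_zero M (p.shift (x, w.1)) w.2 (hsec w.1)
    simp_rw [hz]
    exact hf.comp (by fun_prop : Measurable fun w : B × S => (w.1, ((Fin.elim0, w.2) : Hist S B 0)))
  | succ t ih =>
    have hsec : ∀ b, Measurable (f b) := fun b => hf.comp measurable_prodMk_left
    have hz : ∀ w : B × S, _ := fun w =>
      lintegral_histMeas_succ M (p.shift (x, w.1)) w.2 t (hsec w.1)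
    simp_rw [hz]
    refine ih (f := fun b => stepInt M (p.shift (x, b)) (f b)) ?_
    have hpre : Measurable fun w : B × Hist S B t => Hist.prepend (x, w.1) w.2 :=
      Hist.measurable_prepend.comp (by fun_prop :
        Measurable fun w : B × Hist S B t => ((x, w.1), w.2))
    let κ : Kernel (B × Hist S B t) B := (p.π (t + 1)).comap _ hpre
    have : IsMarkovKernel κ := Kernel.IsMarkovKernel.comap _ _
    refine Measurable.lintegral_kernel_prod_right' (κ := κ) (measurable_lintegral_transition M
      (f := fun b h b' y => f b (Hist.extend h b' y)) ?_)
    exact hf.comp ((by fun_prop : Measurable fun w : ((B × Hist S B t) × B) × S => w.1.1.1).prodMk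
      (Hist.measurable_extend.comp (by fun_prop :
        Measurable fun w : ((B × Hist S B t) × B) × S => ((w.1.1.2, w.1.2), w.2))))

lemma stageInt_succ_eq_lintegral_shift (M : MDP S B) (p : Policy S B) {g : S × B → ℝ≥0∞}
    (hg : Measurable g) (x : S) (t : ℕ) :
    stageInt M p g x (t + 1) = ∫⁻ b, ∫⁻ y, stageInt M (p.shift (x, b)) g y t
      ∂(M.q (x, b)) ∂(p.π 0 (Fin.elim0, x)) :=
  lintegral_histMeas_shift M p x t (measurable_lintegral_policy p (t + 1) hg)

lemma measurable_stageInt_shift (M : MDP S B) (p : Policy S B) {g : S × B → ℝ≥0∞}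
    (hg : Measurable g) (x : S) (t : ℕ) :
    Measurable fun w : B × S => stageInt M (p.shift (x, w.1)) g w.2 t := by
  have hpre : Measurable fun w : B × Hist S B t => Hist.prepend (x, w.1) w.2 :=
    Hist.measurable_prepend.comp (by fun_prop :
      Measurable fun w : B × Hist S B t => ((x, w.1), w.2))
  exact measurable_lintegral_histMeas_shift M p x t
    (f := fun b h => ∫⁻ b', g (h.2, b') ∂(p.π (t + 1) (Hist.prepend (x, b) h)))
    ((measurable_lintegral_policy p (t + 1) hg).comp hpre)

/-- The expected total discounted value of a nonnegative stage cost. -/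
def discInt (M : MDP S B) (g : S × B → ℝ≥0∞) (β : ℝ≥0∞) (p : Policy S B) (x : S) : ℝ≥0∞ :=
  ∑' t, β ^ t * stageInt M p g x t

/-- The optimal expected total discounted value of a nonnegative stage cost. -/
def discOptInt (M : MDP S B) (g : S × B → ℝ≥0∞) (β : ℝ≥0∞) (x : S) : ℝ≥0∞ :=
  ⨅ p : Policy S B, discInt M g β p x

lemma discInt_eq_lintegral_shift (M : MDP S B) {g : S × B → ℝ≥0∞} (hg : Measurable g)
    (β : ℝ≥0∞) (p : Policy S B) (x : S) :
    discInt M g β p x = ∫⁻ b, (g (x, b) + β * ∫⁻ y, discInt M g β (p.shift (x, b)) y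
      ∂(M.q (x, b))) ∂(p.π 0 (Fin.elim0, x)) := by
  have hsec : ∀ b t, Measurable fun y => stageInt M (p.shift (x, b)) g y t := fun b t =>
    (measurable_stageInt_shift M p hg x t).comp measurable_prodMk_left
  have hint : ∀ t, Measurable fun b => ∫⁻ y, stageInt M (p.shift (x, b)) g y t ∂(M.q (x, b)) :=
    fun t => by
      let κ : Kernel B S := M.q.comap (fun b => (x, b)) measurable_prodMk_left
      exact Measurable.lintegral_kernel_prod_right' (κ := κ) (measurable_stageInt_shift M p hg x t)
  have hgx : Measurable fun b => g (x, b) := hg.comp measurable_prodMk_left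
  rw [lintegral_add_left hgx, ← stageInt_zero M p hg]
  have hdisc : ∀ b, ∫⁻ y, discInt M g β (p.shift (x, b)) y ∂(M.q (x, b))
      = ∑' t, β ^ t * ∫⁻ y, stageInt M (p.shift (x, b)) g y t ∂(M.q (x, b)) := fun b => by
    simp only [discInt]
    rw [lintegral_tsum fun t => ((hsec b t).const_mul _).aemeasurable]
    exact tsum_congr fun t => lintegral_const_mul _ (hsec b t)
  simp only [hdisc]
  rw [lintegral_const_mul _ (Measurable.tsum fun t => (hint t).const_mul _),
    lintegral_tsum fun t => ((hint t).const_mul _).aemeasurable, discInt,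
    tsum_eq_zero_add' ENNReal.summable, pow_zero, one_mul, ← ENNReal.tsum_mul_left]
  congr 1
  refine tsum_congr fun t => ?_
  rw [lintegral_const_mul _ (hint t), stageInt_succ_eq_lintegral_shift M p hg, pow_succ',
    mul_assoc]

/-- The optimal discounted value dominates the value of the dynamic programming operator. -/
theorem iInf_le_discOptInt (M : MDP S B) {g : S × B → ℝ≥0∞} (hg : Measurable g)
    (β : ℝ≥0∞) (x : S) :
    ⨅ b, (g (x, b) + β * ∫⁻ y, discOptInt M g β y ∂(M.q (x, b))) ≤ discOptInt M g β x := by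
  refine le_iInf fun p => ?_
  rw [discInt_eq_lintegral_shift M hg]
  calc ⨅ b, (g (x, b) + β * ∫⁻ y, discOptInt M g β y ∂(M.q (x, b)))
      = ∫⁻ _, (⨅ b, (g (x, b) + β * ∫⁻ y, discOptInt M g β y ∂(M.q (x, b))))
          ∂(p.π 0 (Fin.elim0, x)) := by simp
    _ ≤ _ := lintegral_mono fun b => (iInf_le _ b).trans (by
        gcongr with y
        exact iInf_le _ _)

/-- A stationary policy satisfying an average-cost inequality has bounded finite-horizon cost. -/
lemma sum_stageInt_detPolicy_le (M : MDP S B) {g : S × B → ℝ≥0∞} (hg : Measurable g)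
    {φ : S → B} (hφ : Measurable φ) {u : S → ℝ≥0∞} (hu : Measurable u) {w : ℝ≥0∞}
    (h : ∀ x, g (x, φ x) + ∫⁻ y, u y ∂(M.q (x, φ x)) ≤ w + u x) (x : S) (N : ℕ) :
    ∑ t ∈ Finset.range N, stageInt M (detPolicy φ hφ) g x t ≤ N * w + u x := by
  set p := detPolicy φ hφ with hp
  have hstage : ∀ t, stageInt M p g x t = ∫⁻ h, g (h.2, φ h.2) ∂(histMeas M p x t) := fun t => by
    refine lintegral_congr fun h => ?_
    simp only [hp, detPolicy]
    have hgh : Measurable fun b => g (h.2, b) := hg.comp measurable_prodMk_left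
    rw [Kernel.lintegral_deterministic' _ hgh]
  have huh : ∀ t, Measurable fun h : Hist S B t => u h.2 := fun t => hu.comp measurable_snd
  have hstep : ∀ t, ∫⁻ h, u h.2 ∂(histMeas M p x (t + 1))
      = ∫⁻ h, ∫⁻ y, u y ∂(M.q (h.2, φ h.2)) ∂(histMeas M p x t) := fun t => by
    rw [lintegral_histMeas_succ M p x t (huh _)]
    refine lintegral_congr fun h => ?_
    simp only [stepInt, hp, detPolicy, Hist.extend]
    rw [Kernel.lintegral_deterministic']
    exact (Measurable.lintegral_kernel hu).comp measurable_prodMk_left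
  suffices hind : ∑ t ∈ Finset.range N, stageInt M p g x t + ∫⁻ h, u h.2 ∂(histMeas M p x N)
      ≤ N * w + u x from le_self_add.trans hind
  induction N with
  | zero =>
    rw [lintegral_histMeas_zero M p x (huh _)]
    simp
  | succ N ih =>
    have hgφ : Measurable fun h : Hist S B N => g (h.2, φ h.2) :=
      hg.comp (measurable_snd.prodMk (hφ.comp measurable_snd))
    rw [Finset.sum_range_succ, hstage, hstep, add_assoc, ← lintegral_add_left hgφ]
    calc _ ≤ ∑ t ∈ Finset.range N, stageInt M p g x t
            + ∫⁻ h, (w + u h.2) ∂(histMeas M p x N) := by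
          exact add_le_add_right (lintegral_mono fun h' : Hist S B N => h h'.2) _
      _ = w + (∑ t ∈ Finset.range N, stageInt M p g x t
            + ∫⁻ h, u h.2 ∂(histMeas M p x N)) := by
          rw [lintegral_add_left measurable_const, lintegral_const, measure_univ, mul_one]
          ring
      _ ≤ w + (N * w + u x) := by gcongr
      _ = ((N + 1 : ℕ) : ℝ≥0∞) * w + u x := by
          push_cast
          ring

/-- The average-cost inequality bounds the upper Cesàro limit of the stage costs. -/
theorem limsup_average_detPolicy_le (M : MDP S B) {g : S × B → ℝ≥0∞} (hg : Measurable g)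
    {φ : S → B} (hφ : Measurable φ) {u : S → ℝ≥0∞} (hu : Measurable u) {w : ℝ≥0∞}
    (h : ∀ x, g (x, φ x) + ∫⁻ y, u y ∂(M.q (x, φ x)) ≤ w + u x) (x : S) (hx : u x ≠ ⊤) :
    limsup (fun N : ℕ => (N : ℝ≥0∞)⁻¹
      * ∑ t ∈ Finset.range N, stageInt M (detPolicy φ hφ) g x t) atTop ≤ w := by
  have hlim : Tendsto (fun N : ℕ => w + (N : ℝ≥0∞)⁻¹ * u x) atTop (𝓝 w) := by
    simpa using (ENNReal.Tendsto.mul_const ENNReal.tendsto_inv_nat_nhds_zero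
      (Or.inr hx)).const_add w
  rw [← hlim.limsup_eq]
  refine limsup_le_limsup ?_
  filter_upwards [eventually_gt_atTop 0] with N hN
  calc _ ≤ (N : ℝ≥0∞)⁻¹ * (N * w + u x) := by
        gcongr
        exact sum_stageInt_detPolicy_le M hg hφ hu h x N
    _ = w + (N : ℝ≥0∞)⁻¹ * u x := by
        rw [mul_add, ← mul_assoc, ENNReal.inv_mul_cancel (by simpa using hN.ne')
          (ENNReal.natCast_ne_top N), one_mul]

end ControlledChain

/-! ### Inf-compact functions and the average-cost inequality -/

/-- `K`-inf-compactness of a function with values in `ℝ≥0∞`. -/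
def IsKInfCompact {Y B : Type*} [TopologicalSpace Y] [TopologicalSpace B]
    (F : Y × B → ℝ≥0∞) : Prop :=
  ∀ K : Set Y, K.Nonempty → IsCompact K → ∀ l : ℝ≥0∞, l ≠ ⊤ → IsCompact {p | p.1 ∈ K ∧ F p ≤ l}

namespace IsKInfCompact

lemma lowerSemicontinuous {Y B : Type*} [MetricSpace Y] [MetricSpace B] {F : Y × B → ℝ≥0∞}
    (hF : IsKInfCompact F) : LowerSemicontinuous F := by
  refine lowerSemicontinuous_iff_isClosed_preimage.2 fun l => ?_
  rcases eq_or_ne l ⊤ with rfl | hl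
  · simp
  · exact isClosed_of_isCompact_fst_preimage fun K hK hKc => hF K hK hKc l hl

lemma add_lowerSemicontinuous {Y B : Type*} [TopologicalSpace Y] [TopologicalSpace B]
    {F G : Y × B → ℝ≥0∞} (hF : IsKInfCompact F) (hF' : LowerSemicontinuous F)
    (hG : LowerSemicontinuous G) : IsKInfCompact fun p => F p + G p := by
  intro K hK hKc l hl
  have : {p : Y × B | p.1 ∈ K ∧ F p + G p ≤ l}
      = {p | p.1 ∈ K ∧ F p ≤ l} ∩ {p | F p + G p ≤ l} := by
    ext p
    exact ⟨fun h => ⟨⟨h.1, le_self_add.trans h.2⟩, h.2⟩, fun h => ⟨h.1.1, h.2⟩⟩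
  rw [this]
  exact (hF K hK hKc l hl).inter_right
    (lowerSemicontinuous_iff_isClosed_preimage.1 (hF'.add hG) l)

lemma isCompact_section {Y B : Type*} [TopologicalSpace Y] [TopologicalSpace B]
    {F : Y × B → ℝ≥0∞} (hF : IsKInfCompact F) (y : Y) {l : ℝ≥0∞} (hl : l ≠ ⊤) :
    IsCompact {b | F (y, b) ≤ l} := by
  convert (hF {y} (singleton_nonempty y) isCompact_singleton l hl).image continuous_snd
  ext b
  simp

/-- Measurable selection from the sublevel sets of a `K`-inf-compact function. -/
theorem exists_measurable_selector {Y B : Type*} [MetricSpace Y] [MeasurableSpace Y]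
    [BorelSpace Y] [MetricSpace B] [TopologicalSpace.SeparableSpace B] [MeasurableSpace B]
    [BorelSpace B] [Nonempty B] {F : Y × B → ℝ≥0∞} (hF : IsKInfCompact F) {r : Y → ℝ≥0∞}
    (hr : Measurable r) (hfin : ∀ y, r y ≠ ⊤) (hex : ∀ y, ∃ b, F (y, b) ≤ r y) :
    ∃ φ : Y → B, Measurable φ ∧ ∀ y, F (y, φ y) ≤ r y := by
  have hD : IsCompactMeasurable fun y => {b | F (y, b) ≤ r y} := by
    refine ⟨hex, fun y => hF.isCompact_section y (hfin y), fun C hC => ?_⟩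
    have hrw : {y | ({b | F (y, b) ≤ r y} ∩ C).Nonempty} = ⋂ q : ℚ,
        ({y | r y < (Real.toNNReal q : ℝ≥0∞)}ᶜ
          ∪ {y | ∃ b ∈ C, F (y, b) ≤ (Real.toNNReal q : ℝ≥0∞)}) := by
      ext y
      simp only [mem_iInter, mem_union, mem_compl_iff, mem_ofPred_eq, ← imp_iff_not_or]
      constructor
      · rintro ⟨b, hb, hbC⟩ q hq
        exact ⟨b, hbC, le_trans hb hq.le⟩
      · intro h
        have : Nonempty {q : ℚ // r y < (Real.toNNReal q : ℝ≥0∞)} := by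
          obtain ⟨q, -, hq, -⟩ := ENNReal.lt_iff_exists_rat_btwn.1 (hfin y).lt_top
          exact ⟨⟨q, hq⟩⟩
        have hne : (⋂ q : {q : ℚ // r y < (Real.toNNReal q : ℝ≥0∞)},
            {b | F (y, b) ≤ (Real.toNNReal q : ℝ≥0∞)} ∩ C).Nonempty := by
          have hcpt : ∀ q : {q : ℚ // r y < (Real.toNNReal q : ℝ≥0∞)},
              IsCompact ({b | F (y, b) ≤ (Real.toNNReal q : ℝ≥0∞)} ∩ C) := fun q =>
            (hF.isCompact_section y ENNReal.coe_ne_top).inter_right hC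
          have hle : ∀ {q q' : ℚ}, q ≤ q' → (Real.toNNReal q : ℝ≥0∞) ≤ Real.toNNReal q' :=
            fun h => by gcongr
          refine IsCompact.nonempty_iInter_of_directed_nonempty_isCompact_isClosed _
            (fun q q' => ?_) (fun q => ?_) hcpt fun q => (hcpt q).isClosed
          · rcases le_total q.1 q'.1 with hqq | hqq
            · exact ⟨q, subset_rfl, fun b hb => ⟨le_trans hb.1 (hle hqq), hb.2⟩⟩
            · exact ⟨q', fun b hb => ⟨le_trans hb.1 (hle hqq), hb.2⟩, subset_rfl⟩
          · obtain ⟨b, hbC, hb⟩ := h q q.2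
            exact ⟨b, hb, hbC⟩
        obtain ⟨b, hb⟩ := hne
        rw [mem_iInter] at hb
        refine ⟨b, ?_, (hb (Classical.arbitrary _)).2⟩
        refine le_of_forall_gt fun c (hc : r y < c) => ?_
        obtain ⟨q, -, hq, hqc⟩ := ENNReal.lt_iff_exists_rat_btwn.1 hc
        exact (hb ⟨q, hq⟩).1.trans_lt hqc
    rw [hrw]
    refine MeasurableSet.iInter fun q => MeasurableSet.union
      (measurableSet_lt hr measurable_const).compl (IsClosed.measurableSet ?_)
    refine isClosed_of_isCompact_inter fun K hK hKc => ?_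
    convert ((hF K hK hKc _ (ENNReal.coe_ne_top (r := Real.toNNReal q))).inter_right
      (hC.preimage continuous_snd)).image continuous_fst
    ext y
    constructor
    · rintro ⟨hy, b, hbC, hb⟩
      exact ⟨(y, b), ⟨⟨hy, hb⟩, hbC⟩, rfl⟩
    · rintro ⟨⟨y', b⟩, ⟨⟨hy, hb⟩, hbC⟩, rfl⟩
      exact ⟨hy, b, hbC, hb⟩
  exact hD.exists_measurable_selector

end IsKInfCompact

/-- A monotone sequence of inf-compact functions whose infima are frequently almost below a
level `r` has a common point at which the sequence stays below `r`. -/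
lemma exists_forall_le_of_frequently {B : Type*} [TopologicalSpace B] [T2Space B]
    {G : ℕ → B → ℝ≥0∞} (hmono : Monotone G)
    (hG : ∀ k, ∀ l : ℝ≥0∞, l ≠ ⊤ → IsCompact {b | G k b ≤ l}) {ρ : ℕ → ℝ≥0∞} {r : ℝ≥0∞}
    (hr : r ≠ ⊤) (hρ : ∀ l, r < l → ∃ᶠ n in atTop, ρ n < l) (hex : ∀ n, ∃ b, G n b ≤ ρ n) :
    ∃ b, ∀ k, G k b ≤ r := by
  let l : ℕ → ℝ≥0∞ := fun k => r + ((k + 1 : ℕ) : ℝ≥0∞)⁻¹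
  have hl : ∀ k, l k ≠ ⊤ := fun k => ENNReal.add_ne_top.2 ⟨hr, by simp⟩
  have hl_lt : ∀ k, r < l k := fun k => ENNReal.lt_add_right hr (by simp)
  have hl_anti : Antitone l := fun i j hij => by
    dsimp only [l]
    gcongr
  have hl_lim : Tendsto l atTop (𝓝 r) := by
    simpa [l, Function.comp_def] using
      (ENNReal.tendsto_inv_nat_nhds_zero.comp (tendsto_add_atTop_nat 1)).const_add r
  obtain ⟨b, hb⟩ := IsCompact.nonempty_iInter_of_sequence_nonempty_isCompact_isClosed
    (fun k => {b | G k b ≤ l k})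
    (fun k b hb => (hmono k.le_succ b).trans (le_trans hb (hl_anti k.le_succ)))
    (fun k => by
      obtain ⟨n, hn, hkn⟩ := ((hρ _ (hl_lt k)).and_eventually (eventually_ge_atTop k)).exists
      obtain ⟨b, hb⟩ := hex n
      exact ⟨b, (hmono hkn b).trans (hb.trans hn.le)⟩)
    (hG 0 _ (hl 0)) (fun k => (hG k _ (hl k)).isClosed)
  rw [mem_iInter] at hb
  refine ⟨b, fun k => ge_of_tendsto hl_lim ?_⟩
  filter_upwards [eventually_ge_atTop k] with j hj
  exact (hmono hj b).trans (hb j)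

section LowerSemiEquicontinuous

variable {Y : Type*} [TopologicalSpace Y] {u : ℕ → Y → ℝ≥0∞}

lemma lowerSemicontinuous_iInf_of_equi
    (hu : ∀ x, ∀ ε : ℝ≥0∞, ε ≠ 0 → ∀ᶠ y in 𝓝 x, ∀ n, u n x ≤ u n y + ε) (k : ℕ) :
    LowerSemicontinuous fun x => ⨅ n ≥ k, u n x := by
  intro x c hc
  obtain ⟨c', hcc', hc'⟩ := exists_between hc
  filter_upwards [hu x (c' - c) (tsub_pos_of_lt hcc').ne'] with y hy
  by_contra! h
  refine absurd hc' (not_lt.2 ?_)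
  calc ⨅ n ≥ k, u n x ≤ (⨅ n ≥ k, u n y) + (c' - c) := by
        simp only [ENNReal.iInf_add]
        exact iInf₂_mono fun n _ => hy n
    _ ≤ c + (c' - c) := by gcongr
    _ = c' := add_tsub_cancel_of_le hcc'.le

lemma lowerSemicontinuous_liminf_of_equi
    (hu : ∀ x, ∀ ε : ℝ≥0∞, ε ≠ 0 → ∀ᶠ y in 𝓝 x, ∀ n, u n x ≤ u n y + ε) :
    LowerSemicontinuous fun x => liminf (fun n => u n x) atTop := by
  simp only [liminf_eq_iSup_iInf_of_nat]
  exact lowerSemicontinuous_iSup fun k => lowerSemicontinuous_iInf_of_equi hu k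

lemma liminf_eq_liminf_prod_nhds_of_equi
    (hu : ∀ x, ∀ ε : ℝ≥0∞, ε ≠ 0 → ∀ᶠ y in 𝓝 x, ∀ n, u n x ≤ u n y + ε) (x : Y) :
    liminf (fun n => u n x) atTop = liminf (fun p : ℕ × Y => u p.1 p.2) (atTop ×ˢ 𝓝 x) := by
  refine le_antisymm ?_ ?_
  · rw [liminf_eq_iSup_iInf_of_nat]
    refine iSup_le fun k => le_of_forall_lt fun c hc => ?_
    obtain ⟨c', hcc', hc'⟩ := exists_between hc
    refine hcc'.trans_le (le_liminf_of_le (by isBoundedDefault) ?_)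
    filter_upwards [(eventually_ge_atTop k).prod_mk
      (lowerSemicontinuous_iInf_of_equi hu k x c' hc')] with p hp
    exact hp.2.le.trans (iInf₂_le p.1 hp.1)
  · have ht : Tendsto (fun n : ℕ => (n, x)) atTop (atTop ×ˢ 𝓝 x) :=
      tendsto_id.prodMk (tendsto_const_nhds)
    exact ht.liminf_le_liminf_comp

end LowerSemiEquicontinuous

lemma frequently_add_add_lt {b e v : ℕ → ℝ≥0∞} (he : Tendsto e atTop (𝓝 0)) {l : ℝ≥0∞}
    (hl : limsup b atTop + liminf v atTop < l) : ∃ᶠ n in atTop, v n + b n + e n < l := by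
  obtain ⟨r, hr0, hr⟩ := ENNReal.lt_iff_exists_add_pos_lt.1 hl
  have hδ : (r : ℝ≥0∞) / 3 ≠ 0 := by simp [hr0.ne']
  have hsum : limsup b atTop + liminf v atTop + r ≠ ⊤ := hr.ne_top
  simp only [ENNReal.add_ne_top] at hsum
  have hv : ∃ᶠ n in atTop, v n < liminf v atTop + r / 3 :=
    frequently_lt_of_liminf_lt (by isBoundedDefault) (ENNReal.lt_add_right hsum.1.2 hδ)
  have hb : ∀ᶠ n in atTop, b n < limsup b atTop + r / 3 :=
    eventually_lt_of_limsup_lt (ENNReal.lt_add_right hsum.1.1 hδ)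
  have he' : ∀ᶠ n in atTop, e n < r / 3 := he.eventually_lt_const (pos_iff_ne_zero.2 hδ)
  refine (hv.and_eventually (hb.and he')).mono fun n ⟨h1, h2, h3⟩ => ?_
  calc v n + b n + e n ≤ (liminf v atTop + r / 3) + (limsup b atTop + r / 3) + r / 3 := by gcongr
    _ = limsup b atTop + liminf v atTop + (r / 3 + r / 3 + r / 3) := by ring
    _ = limsup b atTop + liminf v atTop + r := by rw [ENNReal.add_thirds]
    _ < l := hr

section AverageCost

variable {S B : Type*} [MetricSpace S] [MeasurableSpace S] [BorelSpace S]
  [MetricSpace B] [TopologicalSpace.SeparableSpace B] [MeasurableSpace B] [BorelSpace B]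

/-- Vanishing discount: a measurable selector for the average-cost inequality satisfied by the
lower limit of the relative discounted values. -/
theorem exists_selector_average_cost_inequality [Nonempty B] (M : MDP S B) {g : S × B → ℝ≥0∞}
    (hg : Measurable g) (hgK : IsKInfCompact g)
    (hq : ∀ f : BoundedContinuousFunction S ℝ, Continuous fun p : S × B => ∫ y, f y ∂(M.q p))
    {β : ℕ → ℝ≥0∞} (hβ : Monotone β) (hβ1 : ∀ n, β n < 1) (hβlim : Tendsto β atTop (𝓝 1))
    {m : ℕ → ℝ≥0∞} (hm : ∀ n, m n ≠ ⊤) {u : ℕ → S → ℝ≥0∞} (hufin : ∀ n x, u n x ≠ ⊤)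
    (huv : ∀ n x, discOptInt M g (β n) x = u n x + m n)
    (hu : ∀ x, ∀ ε : ℝ≥0∞, ε ≠ 0 → ∀ᶠ y in 𝓝 x, ∀ n, u n x ≤ u n y + ε)
    (hU : ∀ x, liminf (fun n => u n x) atTop ≠ ⊤)
    (hw : limsup (fun n => (1 - β n) * m n) atTop ≠ ⊤) :
    ∃ φ : S → B, Measurable φ ∧ ∀ x,
      g (x, φ x) + ∫⁻ y, liminf (fun n => u n y) atTop ∂(M.q (x, φ x))
        ≤ limsup (fun n => (1 - β n) * m n) atTop + liminf (fun n => u n x) atTop := by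
  set w := limsup (fun n => (1 - β n) * m n) atTop
  let U : ℕ → S → ℝ≥0∞ := fun k x => ⨅ n ≥ k, u n x
  have hU_mono : Monotone U := fun i j hij x =>
    le_iInf₂ fun n hn => iInf₂_le n (hij.trans hn)
  have hU_le : ∀ k x, U k x ≤ u k x := fun k x => iInf₂_le k le_rfl
  have hU_lsc : ∀ k, LowerSemicontinuous (U k) := lowerSemicontinuous_iInf_of_equi hu
  have hu_meas : ∀ n, Measurable (u n) := fun n => by
    refine LowerSemicontinuous.measurable fun x c hc => ?_
    obtain ⟨c', hcc', hc'⟩ := exists_between hc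
    filter_upwards [hu x (c' - c) (tsub_pos_of_lt hcc').ne'] with y hy
    by_contra! h
    refine absurd hc' (not_lt.2 ((hy n).trans ?_))
    calc u n y + (c' - c) ≤ c + (c' - c) := by gcongr
      _ = c' := add_tsub_cancel_of_le hcc'.le
  have hlim : ∀ x, liminf (fun n => u n x) atTop = ⨆ k, U k x := fun x =>
    liminf_eq_iSup_iInf_of_nat
  have hu_lsc := lowerSemicontinuous_liminf_of_equi hu
  have hInt_lsc : ∀ {V : S → ℝ≥0∞}, LowerSemicontinuous V → (∀ y, V y ≠ ⊤) →
      LowerSemicontinuous fun p : S × B => ∫⁻ y, V y ∂(M.q p) := fun hV hfin =>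
    lowerSemicontinuous_lintegral_of_weakly_continuous hq hV hfin
  have hF : IsKInfCompact fun p : S × B =>
      g p + ∫⁻ y, liminf (fun n => u n y) atTop ∂(M.q p) :=
    hgK.add_lowerSemicontinuous hgK.lowerSemicontinuous (hInt_lsc hu_lsc hU)
  refine hF.exists_measurable_selector (measurable_const.add hu_lsc.measurable)
    (fun x => ENNReal.add_ne_top.2 ⟨hw, hU x⟩) fun x => ?_
  have hG : ∀ k, IsKInfCompact fun p : S × B => g p + β k * ∫⁻ y, U k y ∂(M.q p) := fun k =>
    hgK.add_lowerSemicontinuous hgK.lowerSemicontinuous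
      ((ENNReal.continuous_const_mul ((hβ1 k).trans_le le_top).ne).comp_lowerSemicontinuous
        (hInt_lsc (hU_lsc k) fun y => ((hU_le k y).trans_lt (hufin k y).lt_top).ne)
        fun _ _ h => mul_le_mul_right h _)
  have hcommon : ∃ b, ∀ k, g (x, b) + β k * ∫⁻ y, U k y ∂(M.q (x, b))
      ≤ w + liminf (fun n => u n x) atTop := by
    refine exists_forall_le_of_frequently
      (ρ := fun n => u n x + (1 - β n) * m n + ((n + 1 : ℕ) : ℝ≥0∞)⁻¹) ?_
      (fun k l hl => (hG k).isCompact_section x hl) (ENNReal.add_ne_top.2 ⟨hw, hU x⟩)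
      (fun l hl => frequently_add_add_lt
        (ENNReal.tendsto_inv_nat_nhds_zero.comp (tendsto_add_atTop_nat 1)) hl) ?_
    · intro i j hij b
      dsimp only
      gcongr with y
      · exact hβ hij
      · exact hU_mono hij y
    · intro n
      have hlt : ⨅ b, (g (x, b) + β n * ∫⁻ y, discOptInt M g (β n) y ∂(M.q (x, b)))
          < discOptInt M g (β n) x + ((n + 1 : ℕ) : ℝ≥0∞)⁻¹ :=
        (iInf_le_discOptInt M hg (β n) x).trans_lt (ENNReal.lt_add_right
          (by rw [huv]; exact ENNReal.add_ne_top.2 ⟨hufin n x, hm n⟩) (by simp))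
      obtain ⟨b, hb⟩ := iInf_lt_iff.1 hlt
      refine ⟨b, ?_⟩
      have hβm : β n * m n ≠ ⊤ := ENNReal.mul_ne_top ((hβ1 n).trans_le le_top).ne (hm n)
      refine (ENNReal.add_le_add_iff_right hβm).1 ?_
      simp only [huv] at hb
      rw [lintegral_add_right _ measurable_const, lintegral_const, measure_univ, mul_one] at hb
      calc g (x, b) + β n * ∫⁻ y, U n y ∂(M.q (x, b)) + β n * m n
          ≤ g (x, b) + β n * (∫⁻ y, u n y ∂(M.q (x, b)) + m n) := by
            rw [mul_add, add_assoc]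
            gcongr with y
            exact hU_le n y
        _ ≤ u n x + m n + ((n + 1 : ℕ) : ℝ≥0∞)⁻¹ := hb.le
        _ = u n x + (1 - β n) * m n + ((n + 1 : ℕ) : ℝ≥0∞)⁻¹ + β n * m n := by
            have : m n = (1 - β n) * m n + β n * m n := by
              rw [← add_mul, tsub_add_cancel_of_le (hβ1 n).le, one_mul]
            nth_rw 1 [this]
            ring
  obtain ⟨b, hb⟩ := hcommon
  refine ⟨b, ?_⟩
  have hInt : Tendsto (fun k => ∫⁻ y, U k y ∂(M.q (x, b))) atTop
      (𝓝 (∫⁻ y, liminf (fun n => u n y) atTop ∂(M.q (x, b)))) := by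
    refine lintegral_tendsto_of_tendsto_of_monotone
      (fun k => (hU_lsc k).measurable.aemeasurable)
      (Eventually.of_forall fun y i j hij => hU_mono hij y) (Eventually.of_forall fun y => ?_)
    rw [hlim]
    exact tendsto_atTop_iSup fun i j hij => hU_mono hij y
  have hmul := ENNReal.Tendsto.mul hβlim (Or.inl one_ne_zero) hInt (Or.inr ENNReal.one_ne_top)
  rw [one_mul] at hmul
  exact le_of_tendsto' (hmul.const_add _) hb

end AverageCost

/-! ### Comparison of the average-cost and discounted-cost values -/

section Chain

variable {S B : Type*} [MeasurableSpace S] [MeasurableSpace B]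

/-- The average value of a nonnegative stage cost under a policy. -/
def avgInt (M : MDP S B) (g : S × B → ℝ≥0∞) (p : Policy S B) (x : S) : ℝ≥0∞ :=
  limsup (fun N : ℕ => (N : ℝ≥0∞)⁻¹ * ∑ t ∈ Finset.range N, stageInt M p g x t) atTop

/-- The minimal optimal discounted value of a nonnegative stage cost. -/
def minDiscInt (M : MDP S B) (g : S × B → ℝ≥0∞) (β : ℝ≥0∞) : ℝ≥0∞ := ⨅ x, discOptInt M g β x

lemma limsup_minDiscInt_le (M : MDP S B) (g : S × B → ℝ≥0∞) (x : S) (f : Filter ℝ) :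
    limsup (fun α : ℝ => ENNReal.ofReal (1 - α) * minDiscInt M g (ENNReal.ofReal α)) f
      ≤ limsup (fun α : ℝ => ENNReal.ofReal (1 - α) * discOptInt M g (ENNReal.ofReal α) x) f :=
  limsup_le_limsup (Eventually.of_forall fun α => by
    dsimp only
    gcongr
    exact iInf_le _ x)

lemma limsup_discOptInt_le_avgInt (M : MDP S B) (g : S × B → ℝ≥0∞) (p : Policy S B) (x : S) :
    limsup (fun α : ℝ => ENNReal.ofReal (1 - α) * discOptInt M g (ENNReal.ofReal α) x)
      (𝓝[Ico 0 1] 1) ≤ avgInt M g p x :=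
  (limsup_le_limsup (Eventually.of_forall fun α => by
    gcongr
    exact iInf_le _ p)).trans (ENNReal.limsup_abel_le_limsup_cesaro fun t => stageInt M p g x t)

lemma limsup_minDiscInt_le_iInf_avgInt (M : MDP S B) (g : S × B → ℝ≥0∞) :
    limsup (fun α : ℝ => ENNReal.ofReal (1 - α) * minDiscInt M g (ENNReal.ofReal α))
      (𝓝[Ico 0 1] 1) ≤ ⨅ x, ⨅ p, avgInt M g p x :=
  le_iInf₂ fun x p => (limsup_minDiscInt_le M g x _).trans (limsup_discOptInt_le_avgInt M g p x)

end Chain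

/-! ### Transfer to extended real-valued costs -/

/-- The extended real number `e - k`. -/
def shift (k e : ℝ≥0∞) : EReal := (e : EReal) - (k : EReal)

section Shift

lemma shift_zero (e : ℝ≥0∞) : shift 0 e = e := by simp [shift]

lemma shift_top {k : ℝ≥0∞} (hk : k ≠ ⊤) : shift k ⊤ = ⊤ := by
  lift k to ℝ≥0 using hk
  exact EReal.top_sub_coe _

lemma shift_add {k k' : ℝ≥0∞} (hk : k ≠ ⊤) (e e' : ℝ≥0∞) :
    shift (k + k') (e + e') = shift k e + shift k' e' := by
  rw [shift, EReal.coe_ennreal_add, EReal.coe_ennreal_add, EReal.add_sub_add_comm]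
  · rfl
  · exact Or.inl (EReal.coe_ennreal_ne_bot _)
  · exact Or.inl (by simpa using hk)

lemma exists_coe_eq_shift {k e : ℝ≥0∞} (hk : k ≠ ⊤) (he : e ≠ ⊤) :
    ∃ r : ℝ, (r : EReal) = shift k e := by
  lift k to ℝ≥0 using hk
  lift e to ℝ≥0 using he
  exact ⟨e - k, rfl⟩

lemma shift_le_shift {k e e' : ℝ≥0∞} (hk : k ≠ ⊤) : shift k e ≤ shift k e' ↔ e ≤ e' := by
  refine ⟨fun h => ?_, fun h => EReal.sub_le_sub (by exact_mod_cast h) le_rfl⟩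
  lift k to ℝ≥0 using hk
  have hadd : ∀ c : ℝ≥0∞, shift k c + ((k : ℝ) : EReal) = c := fun _ => EReal.sub_add_cancel
  have h' := add_le_add_left h ((k : ℝ) : EReal)
  rw [hadd, hadd] at h'
  exact_mod_cast h'

lemma continuous_shift {k : ℝ≥0∞} (hk : k ≠ ⊤) : Continuous (shift k) := by
  refine continuous_iff_continuousAt.2 fun e => ?_
  have h := EReal.continuousAt_add (p := ((e : EReal), -(k : EReal)))
    (Or.inr (by simpa using hk)) (Or.inl (EReal.coe_ennreal_ne_bot _))
  exact ContinuousAt.comp_of_eq (f := fun e : ℝ≥0∞ => ((e : EReal), -(k : EReal))) h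
    (continuous_coe_ennreal_ereal.continuousAt.prodMk continuousAt_const) rfl

lemma shift_mul (k e : ℝ≥0∞) {r : ℝ} (hr : 0 ≤ r) :
    (r : EReal) * shift k e = shift (ENNReal.ofReal r * k) (ENNReal.ofReal r * e) := by
  have hr' : (r : EReal) = (ENNReal.ofReal r : EReal) := by
    rw [EReal.coe_ennreal_ofReal, max_eq_left hr]
  rw [shift, shift, sub_eq_add_neg, EReal.left_distrib_of_nonneg_of_ne_top
    (by exact_mod_cast hr) (EReal.coe_ne_top r), mul_neg, ← sub_eq_add_neg, hr',
    ← EReal.coe_ennreal_mul, ← EReal.coe_ennreal_mul]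

lemma eToENN_shift {k : ℝ≥0∞} (e : ℝ≥0∞) : eToENN (shift k e) = e - k := by
  change (shift k e).toENNReal = e - k
  rw [shift, EReal.toENNReal_sub (EReal.coe_ennreal_nonneg k), EReal.toENNReal_coe,
    EReal.toENNReal_coe]

lemma eToENN_neg_shift {k : ℝ≥0∞} (hk : k ≠ ⊤) (e : ℝ≥0∞) : eToENN (-shift k e) = k - e := by
  rw [shift, EReal.neg_sub (Or.inl (EReal.coe_ennreal_ne_bot _)) (Or.inr (by simpa using hk)),
    add_comm, ← sub_eq_add_neg]
  exact eToENN_shift k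

lemma coe_sub_coe_eq_shift {a b k d : ℝ≥0∞} (hk : k ≠ ⊤) (hd : d ≠ ⊤) (h : a + k = b + d) :
    (a : EReal) - (d : EReal) = shift k b := by
  have h1 := shift_add (k' := k) hd a k
  have h2 := shift_add (k' := d) hk b d
  have hself : ∀ {c : ℝ≥0∞}, c ≠ ⊤ → shift c c = 0 := fun {c} hc => by
    lift c to ℝ≥0 using hc
    exact EReal.sub_self (EReal.coe_ne_top _) (EReal.coe_ne_bot _)
  rw [hself hk, add_zero] at h1
  rw [hself hd, add_zero, ← h, add_comm k d, h1] at h2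
  exact h2

end Shift

section Transfer

/-- The extended integral of a shifted nonnegative function. -/
lemma eInt_shift {Y : Type*} [MeasurableSpace Y] (μ : Measure Y) {k e : Y → ℝ≥0∞}
    (hk : Measurable k) (he : Measurable e) (hfin : ∀ y, k y ≠ ⊤) (hint : ∫⁻ y, k y ∂μ ≠ ⊤) :
    eInt μ (fun y => shift (k y) (e y)) = shift (∫⁻ y, k y ∂μ) (∫⁻ y, e y ∂μ) := by
  simp only [eInt, eToENN_shift, eToENN_neg_shift (hfin _)]
  refine coe_sub_coe_eq_shift hint
    ((lintegral_mono fun y => tsub_le_self).trans_lt hint.lt_top).ne ?_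
  rw [← lintegral_add_right _ hk, ← lintegral_add_left he]
  exact lintegral_congr fun y => by rw [tsub_add_eq_max, add_tsub_eq_max]

/-- The extended sum of a shifted nonnegative sequence. -/
lemma eSum_shift {k e : ℕ → ℝ≥0∞} (hfin : ∀ t, k t ≠ ⊤) (hsum : ∑' t, k t ≠ ⊤) :
    eSum (fun t => shift (k t) (e t)) = shift (∑' t, k t) (∑' t, e t) := by
  have h := eInt_shift Measure.count (measurable_of_countable k) (measurable_of_countable e) hfin
    (by rwa [lintegral_count])
  simpa only [eInt, eSum, lintegral_count] using h

lemma monotone_shift {k : ℝ≥0∞} (hk : k ≠ ⊤) : Monotone (shift k) :=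
  fun _ _ h => (shift_le_shift hk).2 h

lemma shift_iInf {ι : Sort*} {k : ℝ≥0∞} (hk : k ≠ ⊤) (f : ι → ℝ≥0∞) :
    shift k (⨅ i, f i) = ⨅ i, shift k (f i) :=
  (monotone_shift hk).map_iInf_of_continuousAt (continuous_shift hk).continuousAt (shift_top hk)

lemma shift_limsup {ι : Type*} {F : Filter ι} [F.NeBot] {k : ℝ≥0∞} (hk : k ≠ ⊤)
    (f : ι → ℝ≥0∞) : shift k (limsup f F) = limsup (fun i => shift k (f i)) F :=
  (monotone_shift hk).map_limsup_of_continuousAt f (continuous_shift hk).continuousAt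

lemma sum_shift {k : ℝ≥0∞} (hk : k ≠ ⊤) (e : ℕ → ℝ≥0∞) (N : ℕ) :
    ∑ t ∈ Finset.range N, shift k (e t) = shift (N * k) (∑ t ∈ Finset.range N, e t) := by
  induction N with
  | zero => simp [shift]
  | succ N ih =>
    rw [Finset.sum_range_succ, Finset.sum_range_succ, ih, Nat.cast_succ, add_one_mul,
      shift_add (ENNReal.mul_ne_top (ENNReal.natCast_ne_top N) hk)]

variable {S B : Type*} [MeasurableSpace S] [MeasurableSpace B] (M : MDP S B)
  {g : S × B → ℝ≥0∞} {k : ℝ≥0∞}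

lemma exists_eq_shift : ∃ (k : ℝ≥0∞) (g : S × B → ℝ≥0∞), k ≠ ⊤ ∧ Measurable g ∧
    ∀ x b, M.c x b = shift k (g (x, b)) := by
  obtain ⟨K, hK⟩ := M.c_ne_bot
  let k : ℝ≥0 := Real.toNNReal (-K)
  have hk : -((k : ℝ) : EReal) ≤ K := by
    rw [← EReal.coe_neg, EReal.coe_le_coe_iff]
    exact neg_le.1 (Real.le_coe_toNNReal _)
  refine ⟨k, fun p => (M.c p.1 p.2 + ((k : ℝ) : EReal)).toENNReal, ENNReal.coe_ne_top,
    (M.c_meas.add_const _).ereal_toENNReal, fun x b => ?_⟩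
  have hnn : 0 ≤ M.c x b + ((k : ℝ) : EReal) := by
    have h := add_le_add_left (hk.trans (hK x b)) ((k : ℝ) : EReal)
    rwa [← EReal.coe_neg, ← EReal.coe_add, neg_add_cancel, EReal.coe_zero] at h
  rw [shift, EReal.coe_toENNReal hnn]
  exact EReal.add_sub_cancel_right.symm

variable {M}

lemma expCost_eq (hk : k ≠ ⊤) (hg : Measurable g)
    (hc : ∀ x b, M.c x b = shift k (g (x, b))) (p : Policy S B) (x : S) (t : ℕ) :
    expCost M p x t = shift k (stageInt M p g x t) := by
  simp only [expCost, hc]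
  rw [eInt_shift _ measurable_const hg (fun _ => hk) (by simpa using hk),
    lintegral_saMeas _ _ _ _ hg]
  simp

lemma vDisc_eq (hk : k ≠ ⊤) (hg : Measurable g)
    (hc : ∀ x b, M.c x b = shift k (g (x, b))) (p : Policy S B) (x : S) {α : ℝ}
    (hα : α ∈ Ico (0 : ℝ) 1) :
    vDisc M α p x = shift ((1 - ENNReal.ofReal α)⁻¹ * k) (discInt M g (ENNReal.ofReal α) p x) := by
  have hsum : ∑' t, ENNReal.ofReal α ^ t * k = (1 - ENNReal.ofReal α)⁻¹ * k := by
    rw [ENNReal.tsum_mul_right, ENNReal.tsum_geometric]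
  have hα1 : ENNReal.ofReal α < 1 := by simpa using hα.2
  have hfin : (1 - ENNReal.ofReal α)⁻¹ * k ≠ ⊤ :=
    ENNReal.mul_ne_top (ENNReal.inv_ne_top.2 (tsub_pos_of_lt hα1).ne') hk
  simp only [vDisc, expCost_eq hk hg hc, shift_mul _ _ (pow_nonneg hα.1 _),
    ENNReal.ofReal_pow hα.1]
  rw [eSum_shift (fun t => ENNReal.mul_ne_top (by finiteness) hk) (hsum ▸ hfin), hsum]
  rfl

lemma vDiscOpt_eq (hk : k ≠ ⊤) (hg : Measurable g)
    (hc : ∀ x b, M.c x b = shift k (g (x, b))) (x : S) {α : ℝ} (hα : α ∈ Ico (0 : ℝ) 1) :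
    vDiscOpt M α x = shift ((1 - ENNReal.ofReal α)⁻¹ * k) (discOptInt M g (ENNReal.ofReal α) x) := by
  have hα1 : ENNReal.ofReal α < 1 := by simpa using hα.2
  rw [discOptInt, shift_iInf
    (ENNReal.mul_ne_top (ENNReal.inv_ne_top.2 (tsub_pos_of_lt hα1).ne') hk)]
  exact iInf_congr fun p => vDisc_eq hk hg hc p x hα

lemma mDisc_eq (hk : k ≠ ⊤) (hg : Measurable g)
    (hc : ∀ x b, M.c x b = shift k (g (x, b))) {α : ℝ} (hα : α ∈ Ico (0 : ℝ) 1) :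
    mDisc M α = shift ((1 - ENNReal.ofReal α)⁻¹ * k) (minDiscInt M g (ENNReal.ofReal α)) := by
  have hα1 : ENNReal.ofReal α < 1 := by simpa using hα.2
  rw [minDiscInt, shift_iInf
    (ENNReal.mul_ne_top (ENNReal.inv_ne_top.2 (tsub_pos_of_lt hα1).ne') hk)]
  exact iInf_congr fun x => vDiscOpt_eq hk hg hc x hα

lemma one_sub_mul_shift (k e : ℝ≥0∞) {α : ℝ} (hα : α ∈ Ico (0 : ℝ) 1) :
    ((1 - α : ℝ) : EReal) * shift ((1 - ENNReal.ofReal α)⁻¹ * k) e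
      = shift k (ENNReal.ofReal (1 - α) * e) := by
  have hα1 : ENNReal.ofReal α < 1 := by simpa using hα.2
  rw [shift_mul _ _ (sub_nonneg.2 hα.2.le), ENNReal.ofReal_sub _ hα.1, ENNReal.ofReal_one,
    ← mul_assoc, ENNReal.mul_inv_cancel (tsub_pos_of_lt hα1).ne'
      (tsub_le_self.trans_lt ENNReal.one_lt_top).ne, one_mul]

lemma avgCost_eq (hk : k ≠ ⊤) (hg : Measurable g)
    (hc : ∀ x b, M.c x b = shift k (g (x, b))) (p : Policy S B) (x : S) :
    avgCost M p x = shift k (avgInt M g p x) := by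
  rw [avgInt, shift_limsup hk, avgCost]
  refine limsup_congr ?_
  filter_upwards [eventually_gt_atTop 0] with N hN
  have hN' : (0 : ℝ) < N := by exact_mod_cast hN
  simp only [vFin, expCost_eq hk hg hc]
  rw [sum_shift hk, shift_mul _ _ (inv_nonneg.2 hN'.le), ENNReal.ofReal_inv_of_pos hN',
    ENNReal.ofReal_natCast, ← mul_assoc, ENNReal.inv_mul_cancel (by simpa using hN.ne')
      (ENNReal.natCast_ne_top N), one_mul]

lemma avgOpt_eq (hk : k ≠ ⊤) (hg : Measurable g)
    (hc : ∀ x b, M.c x b = shift k (g (x, b))) (x : S) :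
    avgOpt M x = shift k (⨅ p, avgInt M g p x) := by
  rw [shift_iInf hk]
  exact iInf_congr fun p => avgCost_eq hk hg hc p x

lemma wStar_eq (hk : k ≠ ⊤) (hg : Measurable g)
    (hc : ∀ x b, M.c x b = shift k (g (x, b))) : wStar M = shift k (⨅ x, ⨅ p, avgInt M g p x) := by
  rw [shift_iInf hk]
  exact iInf_congr fun x => avgOpt_eq hk hg hc x

lemma limsup_one_sub_mul_vDiscOpt_eq (hk : k ≠ ⊤) (hg : Measurable g)
    (hc : ∀ x b, M.c x b = shift k (g (x, b))) {ι : Type*} {F : Filter ι} [F.NeBot] {α : ι → ℝ}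
    (hα : ∀ᶠ i in F, α i ∈ Ico (0 : ℝ) 1) (x : S) :
    limsup (fun i => ((1 - α i : ℝ) : EReal) * vDiscOpt M (α i) x) F
      = shift k (limsup (fun i => ENNReal.ofReal (1 - α i)
          * discOptInt M g (ENNReal.ofReal (α i)) x) F) := by
  rw [shift_limsup hk]
  refine limsup_congr (hα.mono fun i hi => ?_)
  rw [vDiscOpt_eq hk hg hc x hi, one_sub_mul_shift k _ hi]

lemma limsup_one_sub_mul_mDisc_eq (hk : k ≠ ⊤) (hg : Measurable g)
    (hc : ∀ x b, M.c x b = shift k (g (x, b))) {ι : Type*} {F : Filter ι} [F.NeBot] {α : ι → ℝ}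
    (hα : ∀ᶠ i in F, α i ∈ Ico (0 : ℝ) 1) :
    limsup (fun i => ((1 - α i : ℝ) : EReal) * mDisc M (α i)) F
      = shift k (limsup (fun i => ENNReal.ofReal (1 - α i)
          * minDiscInt M g (ENNReal.ofReal (α i))) F) := by
  rw [shift_limsup hk]
  refine limsup_congr (hα.mono fun i hi => ?_)
  rw [mDisc_eq hk hg hc hi, one_sub_mul_shift k _ hi]

lemma minDiscInt_ne_top_of_uDisc (hk : k ≠ ⊤) (hg : Measurable g)
    (hc : ∀ x b, M.c x b = shift k (g (x, b))) {α : ℝ} (hα : α ∈ Ico (0 : ℝ) 1) {x : S}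
    (hx : uDisc M α x ≠ ⊥) : minDiscInt M g (ENNReal.ofReal α) ≠ ⊤ := by
  have hα1 : ENNReal.ofReal α < 1 := by simpa using hα.2
  have hfin : (1 - ENNReal.ofReal α)⁻¹ * k ≠ ⊤ :=
    ENNReal.mul_ne_top (ENNReal.inv_ne_top.2 (tsub_pos_of_lt hα1).ne') hk
  intro h
  refine hx ?_
  rw [uDisc, mDisc_eq hk hg hc hα, h, shift_top hfin, EReal.sub_top]

lemma uDisc_eq (hk : k ≠ ⊤) (hg : Measurable g)
    (hc : ∀ x b, M.c x b = shift k (g (x, b))) {α : ℝ} (hα : α ∈ Ico (0 : ℝ) 1)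
    (hm : minDiscInt M g (ENNReal.ofReal α) ≠ ⊤) (x : S) :
    uDisc M α x = ((discOptInt M g (ENNReal.ofReal α) x - minDiscInt M g (ENNReal.ofReal α) : ℝ≥0∞)
      : EReal) := by
  have hα1 : ENNReal.ofReal α < 1 := by simpa using hα.2
  have hfin : (1 - ENNReal.ofReal α)⁻¹ * k ≠ ⊤ :=
    ENNReal.mul_ne_top (ENNReal.inv_ne_top.2 (tsub_pos_of_lt hα1).ne') hk
  have hle : minDiscInt M g (ENNReal.ofReal α) ≤ discOptInt M g (ENNReal.ofReal α) x :=
    iInf_le _ x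
  rw [uDisc, mDisc_eq hk hg hc hα, vDiscOpt_eq hk hg hc x hα]
  set m := minDiscInt M g (ENNReal.ofReal α)
  set v := discOptInt M g (ENNReal.ofReal α) x
  set K := (1 - ENNReal.ofReal α)⁻¹ * k
  have hv : shift K v = ((v - m : ℝ≥0∞) : EReal) + shift K m := by
    rw [← shift_zero (v - m), ← shift_add ENNReal.zero_ne_top, zero_add,
      tsub_add_cancel_of_le hle]
  obtain ⟨r, hr⟩ := exists_coe_eq_shift hfin hm
  rw [hv, ← hr]
  exact EReal.add_sub_cancel_right

end Transfer

lemma EReal.liminf_coe_ennreal {ι : Type*} {F : Filter ι} [F.NeBot] (f : ι → ℝ≥0∞) :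
    liminf (fun i => (f i : EReal)) F = ((liminf f F : ℝ≥0∞) : EReal) :=
  (Monotone.map_liminf_of_continuousAt EReal.coe_ennreal_strictMono.monotone f
    continuous_coe_ennreal_ereal.continuousAt).symm

lemma AssumptionWi.isKInfCompact {S B : Type*} [MetricSpace S] [MeasurableSpace S]
    [MetricSpace B] [MeasurableSpace B] {M : MDP S B} (h : AssumptionWi M) {g : S × B → ℝ≥0∞}
    {k : ℝ≥0∞} (hk : k ≠ ⊤) (hc : ∀ x b, M.c x b = shift k (g (x, b))) : IsKInfCompact g := by
  intro K hK hKc l hl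
  obtain ⟨r, hr⟩ := exists_coe_eq_shift hk hl
  have := h K hK hKc r
  simpa only [hc, hr, shift_le_shift hk] using this

/-- If the lower limit of the relative discounted values satisfies the average-cost inequality for
a deterministic policy, that policy is average optimal and every notion of optimal average value
agrees. -/
lemma average_optimal_of_average_cost_inequality {S B : Type*} [MeasurableSpace S]
    [MeasurableSpace B] (M : MDP S B) {g : S × B → ℝ≥0∞} (hg : Measurable g) {a : ℕ → ℝ}
    (ha : Tendsto a atTop (𝓝[Ico (0 : ℝ) 1] 1)) {φ : S → B} (hφ : Measurable φ) {U : S → ℝ≥0∞}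
    (hU : Measurable U) (hU_fin : ∀ x, U x ≠ ⊤) [Nonempty S]
    (h : ∀ x, g (x, φ x) + ∫⁻ y, U y ∂(M.q (x, φ x))
      ≤ limsup (fun n => ENNReal.ofReal (1 - a n) * minDiscInt M g (ENNReal.ofReal (a n))) atTop
        + U x) :
    (∀ x, avgInt M g (detPolicy φ hφ) x = ⨅ x, ⨅ p, avgInt M g p x)
    ∧ limsup (fun n => ENNReal.ofReal (1 - a n) * minDiscInt M g (ENNReal.ofReal (a n))) atTop
        = ⨅ x, ⨅ p, avgInt M g p x
    ∧ limsup (fun α : ℝ => ENNReal.ofReal (1 - α) * minDiscInt M g (ENNReal.ofReal α))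
        (𝓝[Ico 0 1] 1) = ⨅ x, ⨅ p, avgInt M g p x
    ∧ (∀ x, limsup (fun n => ENNReal.ofReal (1 - a n)
        * discOptInt M g (ENNReal.ofReal (a n)) x) atTop = ⨅ x, ⨅ p, avgInt M g p x)
    ∧ ∀ x, limsup (fun α : ℝ => ENNReal.ofReal (1 - α)
        * discOptInt M g (ENNReal.ofReal α) x) (𝓝[Ico 0 1] 1) = ⨅ x, ⨅ p, avgInt M g p x := by
  have hsub := ha.limsup_comp_le_limsup
    (u := fun α : ℝ => ENNReal.ofReal (1 - α) * minDiscInt M g (ENNReal.ofReal α))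
  have hsub_disc := fun x => ha.limsup_comp_le_limsup
    (u := fun α : ℝ => ENNReal.ofReal (1 - α) * discOptInt M g (ENNReal.ofReal α) x)
  have hle := limsup_minDiscInt_le_iInf_avgInt M g
  have hle_disc := limsup_discOptInt_le_avgInt M g (detPolicy φ hφ)
  have hle_seq : ∀ x, limsup (fun n => ENNReal.ofReal (1 - a n)
        * minDiscInt M g (ENNReal.ofReal (a n))) atTop
      ≤ limsup (fun n => ENNReal.ofReal (1 - a n)
        * discOptInt M g (ENNReal.ofReal (a n)) x) atTop := fun x =>
    limsup_le_limsup (Eventually.of_forall fun n => by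
      dsimp only
      gcongr
      exact iInf_le _ x)
  have hle_cont := fun x => limsup_minDiscInt_le M g x (𝓝[Ico (0 : ℝ) 1] 1)
  have havg : ∀ x, avgInt M g (detPolicy φ hφ) x
      ≤ limsup (fun n => ENNReal.ofReal (1 - a n)
        * minDiscInt M g (ENNReal.ofReal (a n))) atTop := fun x =>
    limsup_average_detPolicy_le M hg hφ hU h x (hU_fin x)
  have hinf : ∀ x, ⨅ x, ⨅ p, avgInt M g p x ≤ avgInt M g (detPolicy φ hφ) x := fun x =>
    iInf₂_le x _
  have x₀ := Classical.arbitrary S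
  have hseq := le_antisymm (hsub.trans hle) ((hinf x₀).trans (havg x₀))
  have havg_eq := fun x => le_antisymm ((havg x).trans_eq hseq) (hinf x)
  exact ⟨havg_eq, hseq, le_antisymm hle (hseq.ge.trans hsub),
    fun x => le_antisymm ((hsub_disc x).trans ((hle_disc x).trans_eq (havg_eq x)))
      (hseq.ge.trans (hle_seq x)),
    fun x => le_antisymm ((hle_disc x).trans_eq (havg_eq x))
      (hseq.ge.trans (hsub.trans (hle_cont x)))⟩

lemma exists_uDisc_eq_coe {S B : Type*} [Nonempty S] [MeasurableSpace S] [MeasurableSpace B]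
    {M : MDP S B} {g : S × B → ℝ≥0∞} {k : ℝ≥0∞} (hk : k ≠ ⊤) (hg : Measurable g)
    (hc : ∀ x b, M.c x b = shift k (g (x, b))) {a : ℕ → ℝ} (ha : ∀ n, a n ∈ Ico (0 : ℝ) 1)
    (hbot : ∀ n x, uDisc M (a n) x ≠ ⊥) (htop : ∀ n x, uDisc M (a n) x ≠ ⊤) :
    (∀ n, minDiscInt M g (ENNReal.ofReal (a n)) ≠ ⊤) ∧ ∃ u : ℕ → S → ℝ≥0∞,
      (∀ n x, uDisc M (a n) x = u n x) ∧ (∀ n x, u n x ≠ ⊤) ∧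
      ∀ n x, discOptInt M g (ENNReal.ofReal (a n)) x
        = u n x + minDiscInt M g (ENNReal.ofReal (a n)) := by
  have hm : ∀ n, minDiscInt M g (ENNReal.ofReal (a n)) ≠ ⊤ := fun n =>
    minDiscInt_ne_top_of_uDisc hk hg hc (ha n) (hbot n (Classical.arbitrary S))
  have hu := fun n x => uDisc_eq hk hg hc (ha n) (hm n) x
  refine ⟨hm, fun n x => discOptInt M g (ENNReal.ofReal (a n)) x
    - minDiscInt M g (ENNReal.ofReal (a n)), hu, fun n x h => htop n x ?_, fun n x =>
    (tsub_add_cancel_of_le (iInf_le _ x)).symm⟩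
  rw [hu]
  exact congrArg _ h

/-- A shifted average-cost inequality in terms of the extended integral. -/
lemma eInt_average_cost_inequality {S B : Type*} [MeasurableSpace S] [MeasurableSpace B]
    {M : MDP S B} {g : S × B → ℝ≥0∞} {k : ℝ≥0∞} (hk : k ≠ ⊤)
    (hc : ∀ x b, M.c x b = shift k (g (x, b))) {U : S → ℝ≥0∞} (hU : Measurable U) {w : ℝ≥0∞}
    {x : S} {b : B} (h : g (x, b) + ∫⁻ y, U y ∂(M.q (x, b)) ≤ w + U x) :
    M.c x b + eInt (M.q (x, b)) (fun y => (U y : EReal)) ≤ shift k w + U x := by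
  have hint : eInt (M.q (x, b)) (fun y => (U y : EReal))
      = ((∫⁻ y, U y ∂(M.q (x, b)) : ℝ≥0∞) : EReal) := by
    have h := eInt_shift (M.q (x, b)) (measurable_const (a := 0)) hU
      (fun _ => ENNReal.zero_ne_top) (by simp)
    simpa only [lintegral_zero, shift_zero] using h
  rw [hint, hc, ← shift_zero (U x), ← shift_zero (∫⁻ y, U y ∂_), ← shift_add hk, ← shift_add hk,
    add_zero, shift_le_shift hk]
  exact h
/-- Corollary 3.5. Under Assumptions W* and B̲_{{α_n}}, if the sequence
of functions `{u_{α_n}}` is lower semi-equicontinuous on `X`, then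
`u(x) := liminf_{n→∞} u_{α_n}(x)` coincides with `liminf_{n→∞, y→x} u_{α_n}(y)` for
every `x`, and there exists a deterministic policy `φ` satisfying the WACOI with this
`u`; consequently `φ` is average-cost optimal, `u` is lower semicontinuous, and
`w(x) = w^φ(x) = limsup_n (1-α_n) v_{α_n}(x) = limsup_{α↑1} (1-α) v_α(x)
= w̄ = w̄_{{α_n}} = w*` for all `x`. -/
theorem statement4
    (M : MDP X A)
    (hW1 : AssumptionWi M) (hW2 : AssumptionWii M)
    (a : ℕ → ℝ)
    (ha : ∀ n, a n ∈ Set.Ico (0 : ℝ) 1) (hamono : Monotone a)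
    (hatend : Tendsto a atTop (𝓝 (1 : ℝ)))
    (hB1 : wStar M < ⊤)
    (hB2 : ∀ x, Filter.liminf (fun n => uDisc M (a n) x) atTop < ⊤)
    (hLSEC : ∀ x : X, ∀ ε : ℝ, 0 < ε → ∃ δ > (0 : ℝ), ∀ y : X, dist y x < δ →
      ∀ n : ℕ, uDisc M (a n) x - (ε : EReal) < uDisc M (a n) y) :
    (∀ x, uPointwise M a x = uEqnOne M a x)
    ∧ ∃ (φ : X → A) (hφ : Measurable φ),
      (∀ x, M.c x (φ x) + eInt (M.q (x, φ x)) (uPointwise M a)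
        ≤ wBar M + uPointwise M a x)
      ∧ (∀ x, avgCost M (detPolicy φ hφ) x = avgOpt M x)
      ∧ LowerSemicontinuous (uPointwise M a)
      ∧ (∀ x, avgOpt M x = wStar M
          ∧ avgCost M (detPolicy φ hφ) x = wStar M
          ∧ Filter.limsup (fun n => ((1 - a n : ℝ) : EReal) * vDiscOpt M (a n) x) atTop = wStar M
          ∧ Filter.limsup (fun α : ℝ => ((1 - α : ℝ) : EReal) * vDiscOpt M α x)
              (𝓝[Set.Ico (0 : ℝ) 1] 1) = wStar M)
      ∧ wBar M = wStar M ∧ wBarSeq M a = wStar M := by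
  obtain ⟨k, g, hk, hg, hc⟩ := exists_eq_shift M
  have hα_nhds : Tendsto a atTop (𝓝[Ico (0 : ℝ) 1] 1) :=
    tendsto_nhdsWithin_iff.2 ⟨hatend, Eventually.of_forall ha⟩
  have : (𝓝[Ico (0 : ℝ) 1] (1 : ℝ)).NeBot := right_nhdsWithin_Ico_neBot one_pos
  have hwS_eq : wStar M = shift k (⨅ x, ⨅ p, avgInt M g p x) := wStar_eq hk hg hc
  have hwS_fin : ⨅ x, ⨅ p, avgInt M g p x < ⊤ := lt_top_iff_ne_top.2 fun h => by
    rw [hwS_eq, h, shift_top hk] at hB1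
    exact lt_irrefl _ hB1
  obtain ⟨x₀, p₀, -⟩ : ∃ (x : X) (p : Policy X A), avgInt M g p x < ⊤ := by
    simpa only [iInf_lt_iff] using hwS_fin
  have : Nonempty X := ⟨x₀⟩
  have : Nonempty A := nonempty_of_isProbabilityMeasure (p₀.π 0 (Fin.elim0, x₀))
  have hself : ∀ n x, uDisc M (a n) x - ((1 : ℝ) : EReal) < uDisc M (a n) x := fun n x => by
    obtain ⟨δ, hδ, h⟩ := hLSEC x 1 one_pos
    exact h x (by simpa using hδ) n
  obtain ⟨hm, u, hu_eq, hu_fin, huv⟩ := exists_uDisc_eq_coe hk hg hc ha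
    (fun n x => (bot_le.trans_lt (hself n x)).ne')
    (fun n x h => by
      have h1 := hself n x
      rw [h, EReal.top_sub_coe] at h1
      exact lt_irrefl _ h1)
  have hu_equi : ∀ x, ∀ ε : ℝ≥0∞, ε ≠ 0 → ∀ᶠ y in 𝓝 x, ∀ n, u n x ≤ u n y + ε := by
    intro x ε hε
    rcases eq_or_ne ε ⊤ with rfl | hε'
    · simp
    obtain ⟨δ, hδ, h⟩ := hLSEC x ε.toReal (ENNReal.toReal_pos hε hε')
    filter_upwards [Metric.ball_mem_nhds x hδ] with y hy n
    have h1 := (h y hy n).le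
    rw [hu_eq, hu_eq, EReal.sub_le_iff_le_add (Or.inl (EReal.coe_ne_bot _))
      (Or.inl (EReal.coe_ne_top _)), EReal.coe_ennreal_toReal hε', ← EReal.coe_ennreal_add] at h1
    exact_mod_cast h1
  have hU : uPointwise M a = fun x => ((liminf (fun n => u n x) atTop : ℝ≥0∞) : EReal) :=
    funext fun x => by simp only [uPointwise, hu_eq, EReal.liminf_coe_ennreal]
  have hU_fin : ∀ x, liminf (fun n => u n x) atTop ≠ ⊤ := fun x h => by
    have h1 : uPointwise M a x < ⊤ := hB2 x
    simp only [hU, h] at h1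
    exact lt_irrefl _ h1
  have hU_lsc := lowerSemicontinuous_liminf_of_equi hu_equi
  have hseq_le := (hα_nhds.limsup_comp_le_limsup
    (u := fun α : ℝ => ENNReal.ofReal (1 - α) * minDiscInt M g (ENNReal.ofReal α))).trans
    (limsup_minDiscInt_le_iInf_avgInt M g)
  have hβ_sub : ∀ n, 1 - ENNReal.ofReal (a n) = ENNReal.ofReal (1 - a n) := fun n => by
    rw [ENNReal.ofReal_sub _ (ha n).1, ENNReal.ofReal_one]
  obtain ⟨φ, hφ, hacoi⟩ := exists_selector_average_cost_inequality M hg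
    (hW1.isKInfCompact hk hc) hW2 (fun i j hij => ENNReal.ofReal_le_ofReal (hamono hij))
    (fun n => by simpa using (ha n).2) (by simpa using ENNReal.tendsto_ofReal hatend)
    hm hu_fin huv hu_equi hU_fin (by
      simp only [hβ_sub]
      exact (hseq_le.trans_lt hwS_fin).ne)
  simp only [hβ_sub] at hacoi
  obtain ⟨havg, hseq, hcont, hdiscSeq, hdisc⟩ := average_optimal_of_average_cost_inequality M hg
    hα_nhds hφ hU_lsc.measurable hU_fin hacoi
  have havgCost : ∀ x, avgCost M (detPolicy φ hφ) x = wStar M := fun x => by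
    rw [avgCost_eq hk hg hc, havg, hwS_eq]
  have havgOpt : ∀ x, avgOpt M x = wStar M := fun x =>
    le_antisymm ((iInf_le _ _).trans_eq (havgCost x)) (iInf_le _ x)
  have hwBar : wBar M = wStar M := by
    rw [hwS_eq, ← hcont]
    exact limsup_one_sub_mul_mDisc_eq hk hg hc
      (F := 𝓝[Ico (0 : ℝ) 1] 1) (α := fun α : ℝ => α) self_mem_nhdsWithin
  refine ⟨fun x => ?_, φ, hφ, fun x => ?_, fun x => (havgCost x).trans (havgOpt x).symm, ?_,
    fun x => ⟨havgOpt x, havgCost x, ?_, ?_⟩, hwBar, ?_⟩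
  · simp only [hU, uEqnOne, hu_eq, EReal.liminf_coe_ennreal]
    exact congrArg _ (liminf_eq_liminf_prod_nhds_of_equi hu_equi x)
  · rw [hU, hwBar, hwS_eq, ← hseq]
    exact eInt_average_cost_inequality hk hc hU_lsc.measurable (hacoi x)
  · rw [hU]
    exact continuous_coe_ennreal_ereal.comp_lowerSemicontinuous hU_lsc
      EReal.coe_ennreal_strictMono.monotone
  · rw [limsup_one_sub_mul_vDiscOpt_eq hk hg hc (Eventually.of_forall ha), hwS_eq, hdiscSeq x]
  · rw [hwS_eq, ← hdisc x]
    exact limsup_one_sub_mul_vDiscOpt_eq hk hg hc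
      (F := 𝓝[Ico (0 : ℝ) 1] 1) (α := fun α : ℝ => α) self_mem_nhdsWithin x
  · rw [hwS_eq, ← hseq]
    exact limsup_one_sub_mul_mDisc_eq hk hg hc (Eventually.of_forall ha)

end Statements

end
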